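/- Let n ≥ 2 and p ≥ 1, and let conjugacy classes c_1,…,c_{p+1} ⊂ gl(n,ℂ) be given, where c_1 has n distinct eigenvalues and the traces satisfy tr(B_1) + ⋯ + tr(B_{p+1}) = 0. If r_2 + ⋯ + r_{p+1} ≥ n + 1, then there exists an irreducible tuple (A_1,…,A_{p+1}) with A_j ∈ c_j and A_1 + ⋯ + A_{p+1} = 0 (the eigenvalues being arbitrary). -/

import Mathlib

open Polynomial BigOperators

noncomputable def rk {n : ℕ} (Y : Matrix (Fin n) (Fin n) ℂ) : ℕ :=
  ⨅ μ : ℂ, (Y - μ • (1 : Matrix (Fin n) (Fin n) ℂ)).rank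

/-- The submodule of matrices commuting with `Y`. -/
noncomputable def centSub {n : ℕ} (Y : Matrix (Fin n) (Fin n) ℂ) : Submodule ℂ (Matrix (Fin n) (Fin n) ℂ) where
  carrier := {Z | Y * Z = Z * Y}
  add_mem' := by
    intro a b ha hb
    simp only [Set.mem_setOf_eq] at *
    rw [Matrix.mul_add, Matrix.add_mul, ha, hb]
  zero_mem' := by simp
  smul_mem' := by
    intro c a ha
    simp only [Set.mem_setOf_eq] at *
    rw [Matrix.mul_smul, Matrix.smul_mul, ha]

/-- `d(Y) = n² - dim of centralizer of Y`, the dimension of the conjugacy class. -/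
noncomputable def dd {n : ℕ} (Y : Matrix (Fin n) (Fin n) ℂ) : ℕ :=
  n ^ 2 - Module.finrank ℂ (centSub Y)

def SameClass {n : ℕ} (A B : Matrix (Fin n) (Fin n) ℂ) : Prop :=
  ∃ S : Matrix (Fin n) (Fin n) ℂ, IsUnit S ∧ A = S * B * S⁻¹

def IrreducibleTuple {n q : ℕ} (A : Fin q → Matrix (Fin n) (Fin n) ℂ) : Prop :=
  ∀ W : Submodule ℂ (Fin n → ℂ), (∀ j, ∀ v ∈ W, (A j).mulVec v ∈ W) → W = ⊥ ∨ W = ⊤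

def TrivialCentralizer {n q : ℕ} (A : Fin q → Matrix (Fin n) (Fin n) ℂ) : Prop :=
  ∀ Z : Matrix (Fin n) (Fin n) ℂ, (∀ j, Z * A j = A j * Z) →
    ∃ c : ℂ, Z = c • (1 : Matrix (Fin n) (Fin n) ℂ)

def HasDistinctEigenvalues {n : ℕ} (Y : Matrix (Fin n) (Fin n) ℂ) : Prop :=
  ∃ μ : Fin n → ℂ, Function.Injective μ ∧ Y.charpoly = ∏ k, (Polynomial.X - Polynomial.C (μ k))

def IsDiagble {n : ℕ} (Y : Matrix (Fin n) (Fin n) ℂ) : Prop :=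
  ∃ S : Matrix (Fin n) (Fin n) ℂ, IsUnit S ∧ ∃ d : Fin n → ℂ, Y = S * Matrix.diagonal d * S⁻¹

noncomputable def multOf {n : ℕ} (Y : Matrix (Fin n) (Fin n) ℂ) (μ : ℂ) : ℕ :=
  Module.finrank ℂ (LinearMap.ker (Y - μ • (1 : Matrix (Fin n) (Fin n) ℂ)).mulVecLin)

/-- The Sylvester map `X ↦ P X - X R`. -/
noncomputable def sylv {l m : ℕ} (P : Matrix (Fin l) (Fin l) ℂ) (R : Matrix (Fin m) (Fin m) ℂ) :
    Matrix (Fin l) (Fin m) ℂ →ₗ[ℂ] Matrix (Fin l) (Fin m) ℂ where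
  toFun Z := P * Z - Z * R
  map_add' Z W := by
    show P * (Z + W) - (Z + W) * R = (P * Z - Z * R) + (P * W - W * R)
    rw [Matrix.mul_add, Matrix.add_mul]; abel
  map_smul' c Z := by
    show P * (c • Z) - (c • Z) * R = c • (P * Z - Z * R)
    rw [Matrix.mul_smul, Matrix.smul_mul, smul_sub]

noncomputable def sDim {l m : ℕ} (P : Matrix (Fin l) (Fin l) ℂ) (R : Matrix (Fin m) (Fin m) ℂ) : ℕ :=
  Module.finrank ℂ (LinearMap.range (sylv P R))


section GenLemmas
variable {V : Type*} [AddCommGroup V] [Module ℂ V] [FiniteDimensional ℂ V]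

lemma gen_aux (m : ℕ) : ∀ T : Finset (Submodule ℂ V),
    (∀ R ∈ T, Module.finrank ℂ V ≤ Module.finrank ℂ R + m) →
    ∃ v : Fin m → V, ∀ R ∈ T, R ⊔ Submodule.span ℂ (Set.range v) = ⊤ := by
  induction m with
  | zero =>
    intro T hT
    refine ⟨fun i => i.elim0, fun R hR => ?_⟩
    have := hT R hR
    have h2 : R = ⊤ := Submodule.eq_top_of_finrank_eq (le_antisymm (Submodule.finrank_le R) (by simpa using this))
    simp [h2]
  | succ m ih =>
    intro T hT
    classical
    obtain ⟨v0, hv0⟩ : ∃ v0 : V, ∀ R ∈ T, R ≠ ⊤ → v0 ∉ R := by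
      by_contra hcon
      push Not at hcon
      have := Subspace.biUnion_ne_univ_of_top_notMem (k := ℂ) (E := V)
        (s := (T.filter (fun R => R ≠ ⊤))) (by simp)
      apply this
      ext x
      simp only [Set.mem_iUnion, Set.mem_univ, iff_true]
      obtain ⟨R, hR, h1, h2⟩ := hcon x
      exact ⟨R, by simp [hR, h1], h2⟩
    obtain ⟨v, hv⟩ := ih (T.image (fun R => R ⊔ Submodule.span ℂ {v0})) (by
      intro R' hR'
      obtain ⟨R, hR, rfl⟩ := Finset.mem_image.1 hR'
      by_cases h : R = ⊤
      · subst h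
        rw [top_sup_eq, finrank_top]
        omega
      · have h1 : R < R ⊔ Submodule.span ℂ {v0} := by
          refine lt_of_le_of_ne le_sup_left (fun he => hv0 R hR h ?_)
          rw [he]
          exact Submodule.mem_sup_right (Submodule.mem_span_singleton_self v0)
        have := Submodule.finrank_lt_finrank_of_lt h1
        have := hT R hR
        omega)
    refine ⟨Fin.cons v0 v, fun R hR => ?_⟩
    have := hv _ (Finset.mem_image_of_mem _ hR)
    rw [Fin.range_cons, Submodule.span_insert, ← sup_assoc]
    exact this

lemma gen_exists (f : Module.End ℂ V) (m : ℕ)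
    (h : ∀ μ : ℂ, Module.finrank ℂ V ≤ Module.finrank ℂ (LinearMap.range (f - algebraMap ℂ _ μ)) + m) :
    ∃ v : Fin m → V, ∀ W : Submodule ℂ V, (∀ k, v k ∈ W) → (∀ w ∈ W, f w ∈ W) → W = ⊤ := by
  classical
  have hfin : Set.Finite {μ : ℂ | f.HasEigenvalue μ} := Module.End.finite_hasEigenvalue f
  obtain ⟨v, hv⟩ := gen_aux m (hfin.toFinset.image
    (fun μ => LinearMap.range (f - algebraMap ℂ (Module.End ℂ V) μ))) (by
      intro R hR
      obtain ⟨μ, _, rfl⟩ := Finset.mem_image.1 hR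
      exact h μ)
  refine ⟨v, fun W hvW hfW => ?_⟩
  by_contra hW
  haveI : Nontrivial (V ⧸ W) := Submodule.Quotient.nontrivial_iff.2 hW
  let fb : Module.End ℂ (V ⧸ W) := W.mapQ W f hfW
  obtain ⟨μ, hμ⟩ := Module.End.exists_eigenvalue fb
  have hsurj : LinearMap.range (f - algebraMap ℂ (Module.End ℂ V) μ) ⊔ W = ⊤ := by
    by_cases hev : f.HasEigenvalue μ
    · have := hv _ (Finset.mem_image_of_mem _ ((Set.Finite.mem_toFinset hfin).2 hev))
      rw [eq_top_iff, ← this]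
      refine sup_le_sup_left ?_ _
      rw [Submodule.span_le]
      rintro _ ⟨k, rfl⟩
      exact hvW k
    · have hk : LinearMap.ker (f - algebraMap ℂ (Module.End ℂ V) μ) = ⊥ := by
        by_contra hne
        exact hev (by rw [Module.End.hasEigenvalue_iff, Module.End.eigenspace_def]; exact hne)
      rw [LinearMap.ker_eq_bot_iff_range_eq_top.1 hk]
      simp
  have hs2 : Function.Surjective (fb - algebraMap ℂ (Module.End ℂ (V ⧸ W)) μ) := by
    intro y
    obtain ⟨x, rfl⟩ := W.mkQ_surjective y
    have hx : x ∈ LinearMap.range (f - algebraMap ℂ (Module.End ℂ V) μ) ⊔ W := by rw [hsurj]; trivial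
    obtain ⟨a, ⟨z, rfl⟩, w, hw, rfl⟩ := Submodule.mem_sup.1 hx
    refine ⟨W.mkQ z, ?_⟩
    have : W.mkQ w = 0 := by simpa using hw
    rw [map_add, this, add_zero]
    simp [fb, Module.algebraMap_end_apply]
  have hi := LinearMap.injective_iff_surjective.2 hs2
  obtain ⟨x, hx⟩ := hμ.exists_hasEigenvector
  apply hx.2
  apply hi
  simp [Module.algebraMap_end_apply, hx.apply_eq_smul]

/-- chain span -/
def chainSpan {ι : Type*} (f : Module.End ℂ V) (s : ι → ℕ) (v : ι → V) : Submodule ℂ V :=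
  Submodule.span ℂ {x | ∃ k l, l < s k ∧ x = (f ^ l) (v k)}

lemma mem_chainSpan {ι : Type*} {f : Module.End ℂ V} {s : ι → ℕ} {v : ι → V} {k : ι} {l : ℕ}
    (h : l < s k) : (f ^ l) (v k) ∈ chainSpan f s v :=
  Submodule.subset_span ⟨k, l, h, rfl⟩

lemma exists_chain (f : Module.End ℂ V) (m : ℕ)
    (h : ∀ μ : ℂ, Module.finrank ℂ V ≤ Module.finrank ℂ (LinearMap.range (f - algebraMap ℂ _ μ)) + m) :
    ∃ (s : Fin m → ℕ) (v : Fin m → V), chainSpan f s v = ⊤ := by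
  obtain ⟨v, hv⟩ := gen_exists f m h
  let W : ℕ →o Submodule ℂ V := ⟨fun L => chainSpan f (fun _ => L) v, by
    intro a b hab
    apply Submodule.span_mono
    rintro x ⟨k, l, hl, rfl⟩
    exact ⟨k, l, lt_of_lt_of_le hl hab, rfl⟩⟩
  obtain ⟨L, hL⟩ := monotone_stabilizes_iff_noetherian.2 (inferInstance : IsNoetherian ℂ V) W
  refine ⟨fun _ => L + 1, v, hv _ ?_ ?_⟩
  · intro k
    exact mem_chainSpan (f := f) (s := fun _ => L + 1) (v := v) (k := k) (l := 0) (by simp)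
  · intro w hw
    have h1 : W (L + 1) = W (L + 2) := by rw [← hL (L+1) (by omega), ← hL (L+2) (by omega)]
    change f w ∈ W (L + 1)
    rw [h1]
    change w ∈ chainSpan f (fun _ => L + 1) v at hw
    have : chainSpan f (fun _ => L + 1) v ≤ Submodule.comap f (W (L + 2)) := by
      apply Submodule.span_le.2
      rintro x ⟨k, l, hl, rfl⟩
      change f ((f ^ l) (v k)) ∈ chainSpan f (fun _ => L + 2) v
      rw [← Module.End.mul_apply, ← pow_succ']
      exact mem_chainSpan (by simp at hl; omega)
    exact this hw

lemma exists_min_chain (f : Module.End ℂ V) (m : ℕ)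
    (h : ∀ μ : ℂ, Module.finrank ℂ V ≤ Module.finrank ℂ (LinearMap.range (f - algebraMap ℂ _ μ)) + m) :
    ∃ (s : Fin m → ℕ) (v : Fin m → V), chainSpan f s v = ⊤ ∧ (∀ i j, s i ≤ s j + 1) ∧
      LinearIndependent ℂ (fun x : Σ k, Fin (s k) => (f ^ (x.2 : ℕ)) (v x.1)) := by
  classical
  have hex : ∃ q : ℕ, ∃ (s : Fin m → ℕ) (v : Fin m → V), chainSpan f s v = ⊤ ∧ ∑ k, s k ^ 2 = q := by
    obtain ⟨s, v, hsv⟩ := exists_chain f m h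
    exact ⟨_, s, v, hsv, rfl⟩
  obtain ⟨s, v, hsv, hq⟩ := Nat.find_spec hex
  have hmin : ∀ (s' : Fin m → ℕ) (v' : Fin m → V), chainSpan f s' v' = ⊤ →
      ∑ k, s k ^ 2 ≤ ∑ k, s' k ^ 2 := by
    intro s' v' h'
    rw [hq]
    exact Nat.find_min' hex ⟨s', v', h', rfl⟩
  refine ⟨s, v, hsv, ?_, ?_⟩
  · intro i j
    by_contra hij
    have hij : s j + 2 ≤ s i := by omega
    have hne : i ≠ j := by rintro rfl; omega
    set top := (f ^ (s i - 1)) (v i) with htop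
    set U := chainSpan f (Function.update s i (s i - 1)) v with hU
    have hUt : U ⊔ Submodule.span ℂ {top} = ⊤ := by
      rw [eq_top_iff, ← hsv]
      apply Submodule.span_le.2
      rintro x ⟨k, l, hl, rfl⟩
      by_cases hk : k = i
      · subst hk
        by_cases hl2 : l = s k - 1
        · subst hl2
          exact Submodule.mem_sup_right (Submodule.mem_span_singleton_self _)
        · exact Submodule.mem_sup_left (mem_chainSpan (by simp; omega))
      · exact Submodule.mem_sup_left (mem_chainSpan (by simp [hk]; omega))
    have hx : (f ^ (s j)) (v j) ∈ U ⊔ Submodule.span ℂ {top} := by rw [hUt]; trivial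
    obtain ⟨u, hu, w, hw, huw⟩ := Submodule.mem_sup.1 hx
    obtain ⟨α, rfl⟩ := Submodule.mem_span_singleton.1 hw
    set v' := Function.update v j (v j + (1 - α) • (f ^ (s i - 1 - s j)) (v i)) with hv'
    set s' := Function.update (Function.update s i (s i - 1)) j (s j + 1) with hs'
    have hv'j : v' j = v j + (1 - α) • (f ^ (s i - 1 - s j)) (v i) := by simp [hv']
    have hv'i : v' i = v i := by simp [hv', hne]
    have hs'i : s' i = s i - 1 := by simp [hs', hne]
    have hs'j : s' j = s j + 1 := by simp [hs']
    have hother : ∀ k, k ≠ i → k ≠ j → s' k = s k ∧ v' k = v k := by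
      intro k h1 h2; simp [hs', hv', h1, h2]
    have hvi : ∀ l, l < s i - 1 → (f ^ l) (v i) ∈ chainSpan f s' v' := by
      intro l hl
      rw [← hv'i]
      exact mem_chainSpan (by omega)
    have hUU : U ≤ chainSpan f s' v' := by
      apply Submodule.span_le.2
      rintro x ⟨k, l, hl, rfl⟩
      by_cases hki : k = i
      · subst hki
        simp at hl
        exact hvi l hl
      · rw [Function.update_of_ne hki] at hl
        by_cases hkj : k = j
        · subst hkj
          have h1 : (f ^ l) (v' k) ∈ chainSpan f s' v' := mem_chainSpan (by omega)
          rw [hv'j, map_add, map_smul, ← Module.End.mul_apply, ← pow_add] at h1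
          have h2 := hvi (l + (s i - 1 - s k)) (by omega)
          have := Submodule.sub_mem _ h1 (Submodule.smul_mem _ (1 - α) h2)
          simpa using this
        · obtain ⟨h1, h2⟩ := hother k hki hkj
          change (f ^ l) (v k) ∈ chainSpan f s' v'
          rw [← h2]
          exact mem_chainSpan (by omega)
    have htopm : top ∈ chainSpan f s' v' := by
      have h1 : (f ^ (s j)) (v' j) ∈ chainSpan f s' v' := mem_chainSpan (by omega)
      rw [hv'j, map_add, map_smul, ← Module.End.mul_apply, ← pow_add, ← huw,
        show s j + (s i - 1 - s j) = s i - 1 by omega, ← htop] at h1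
      have h2 := Submodule.sub_mem _ h1 (hUU hu)
      have h3 : u + α • top + (1 - α) • top - u = top := by module
      rwa [h3] at h2
    have hT : chainSpan f s' v' = ⊤ := by
      rw [eq_top_iff, ← hUt]
      refine sup_le hUU ?_
      rw [Submodule.span_singleton_le_iff_mem]
      exact htopm
    have := hmin s' v' hT
    have hlt : ∑ k, s' k ^ 2 < ∑ k, s k ^ 2 := by
      rw [← Finset.add_sum_erase _ _ (Finset.mem_univ i), ← Finset.add_sum_erase _ (fun k => s k ^ 2) (Finset.mem_univ i),
        ← Finset.add_sum_erase _ _ (Finset.mem_erase.2 ⟨hne.symm, Finset.mem_univ j⟩),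
        ← Finset.add_sum_erase _ (fun k => s k ^ 2) (Finset.mem_erase.2 ⟨hne.symm, Finset.mem_univ j⟩)]
      have : ∑ x ∈ (Finset.univ.erase i).erase j, s' x ^ 2 = ∑ x ∈ (Finset.univ.erase i).erase j, s x ^ 2 := by
        apply Finset.sum_congr rfl
        intro x hx
        simp at hx
        rw [(hother x hx.2 hx.1).1]
      rw [this, hs'i, hs'j]
      obtain ⟨a, ha⟩ : ∃ a, s i = s j + 2 + a := ⟨s i - (s j + 2), by omega⟩
      rw [ha]
      have : s j + 2 + a - 1 = s j + 1 + a := by omega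
      rw [this]
      nlinarith
    omega
  · by_contra hli
    rw [Fintype.not_linearIndependent_iff] at hli
    obtain ⟨g, hg, x1, hx1⟩ := hli
    obtain ⟨x0, hx0m, hx0⟩ := Finset.exists_min_image (Finset.univ.filter (fun x => g x ≠ 0))
      (fun x : Σ k, Fin (s k) => s x.1 - (x.2 : ℕ)) ⟨x1, by simp [hx1]⟩
    simp only [Finset.mem_filter, Finset.mem_univ, true_and] at hx0m hx0
    obtain ⟨k0, l0⟩ := x0
    simp only at hx0
    have hl0 := l0.2
    set d := s k0 - (l0 : ℕ) with hd
    have hd1 : 1 ≤ d := by omega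
    have h1 := congrArg (f ^ (d - 1)) hg
    rw [map_sum, map_zero, ← Finset.add_sum_erase _ _ (Finset.mem_univ ⟨k0, l0⟩)] at h1
    set s' := Function.update s k0 (s k0 - 1) with hs'
    have hmem : ∑ x ∈ Finset.univ.erase (⟨k0, l0⟩ : Σ k, Fin (s k)),
        (f ^ (d - 1)) (g x • (f ^ (x.2 : ℕ)) (v x.1)) ∈ chainSpan f s' v := by
      apply Submodule.sum_mem
      rintro ⟨k, l⟩ hx
      have hxne := (Finset.mem_erase.1 hx).1
      rw [map_smul]
      by_cases hgx : g ⟨k, l⟩ = 0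
      · rw [hgx, zero_smul]; exact Submodule.zero_mem _
      · apply Submodule.smul_mem
        have h2 := hx0 _ hgx
        simp only at h2 ⊢
        have hl := l.2
        rw [← Module.End.mul_apply, ← pow_add]
        apply mem_chainSpan
        by_cases hk : k = k0
        · subst hk
          simp only [hs', Function.update_self]
          have : (l : ℕ) ≠ l0 := by
            intro h; apply hxne; congr; exact Fin.ext h
          omega
        · simp only [hs', Function.update_of_ne hk]
          omega
    have htop : (f ^ (s k0 - 1)) (v k0) ∈ chainSpan f s' v := by
      have h3 := eq_neg_of_add_eq_zero_left h1
      rw [map_smul, ← Module.End.mul_apply, ← pow_add] at h3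
      simp only at h3
      rw [show d - 1 + (l0 : ℕ) = s k0 - 1 by omega] at h3
      have h4 : g ⟨k0, l0⟩ • (f ^ (s k0 - 1)) (v k0) ∈ chainSpan f s' v := by
        rw [h3]; exact Submodule.neg_mem _ hmem
      exact (Submodule.smul_mem_iff _ hx0m).1 h4
    have hT : chainSpan f s' v = ⊤ := by
      rw [eq_top_iff, ← hsv]
      apply Submodule.span_le.2
      rintro x ⟨k, l, hl, rfl⟩
      by_cases hk : k = k0
      · subst hk
        by_cases hl2 : l = s k - 1
        · subst hl2; exact htop
        · exact mem_chainSpan (by simp [hs']; omega)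
      · exact mem_chainSpan (by simp [hs', hk]; omega)
    have := hmin s' v hT
    have hlt : ∑ k, s' k ^ 2 < ∑ k, s k ^ 2 := by
      apply Finset.sum_lt_sum
      · intro i _
        by_cases hk : i = k0
        · subst hk; simp only [hs', Function.update_self]
          exact Nat.pow_le_pow_left (by omega) 2
        · simp [hs', hk]
      · refine ⟨k0, Finset.mem_univ _, ?_⟩
        simp only [hs', Function.update_self]
        exact Nat.pow_lt_pow_left (by omega) (by norm_num)
    omega

end GenLemmas

lemma balanced_perm {m : ℕ} (s s' : Fin m → ℕ) (hs : ∀ i j, s i ≤ s j + 1) (hs' : ∀ i j, s' i ≤ s' j + 1)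
    (hsum : ∑ k, s k = ∑ k, s' k) : ∃ σ : Equiv.Perm (Fin m), ∀ k, s' (σ k) = s k := by
  classical
  rcases Nat.eq_zero_or_pos m with rfl | hm
  · exact ⟨1, fun k => k.elim0⟩
  set n := ∑ k, s k with hn
  have key : ∀ s : Fin m → ℕ, (∀ i j, s i ≤ s j + 1) → ∑ k, s k = n →
      (∀ i, s i = n / m ∨ s i = n / m + 1) ∧ (Finset.univ.filter (fun i => s i = n / m + 1)).card = n % m := by
    intro s hs hsum
    have hA : ∀ i, s i = n / m ∨ s i = n / m + 1 := by
      intro i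
      by_contra hcon
      push Not at hcon
      rcases lt_or_gt_of_ne hcon.1 with h1 | h1
      · have : ∑ k, s k < ∑ k : Fin m, n / m := by
          apply Finset.sum_lt_sum
          · intro k _
            have := hs k i; omega
          · exact ⟨i, Finset.mem_univ _, h1⟩
        simp at this
        have h3 := Nat.mul_div_le n m
        omega
      · have : ∑ k : Fin m, (n / m + 1) ≤ ∑ k, s k := by
          apply Finset.sum_le_sum
          intro k _
          have := hs i k; omega
        simp at this
        have h3 := Nat.lt_mul_div_succ n hm
        omega
    refine ⟨hA, ?_⟩
    have : ∀ i, s i = n / m + if s i = n / m + 1 then 1 else 0 := by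
      intro i
      rcases hA i with h | h <;> simp [h]
    have h2 : ∑ k, s k = m * (n / m) + (Finset.univ.filter (fun i => s i = n / m + 1)).card := by
      rw [Finset.sum_congr rfl (fun i _ => this i), Finset.sum_add_distrib]
      simp
    have := Nat.div_add_mod n m
    omega
  obtain ⟨a1, a2⟩ := key s hs rfl
  obtain ⟨b1, b2⟩ := key s' hs' hsum.symm
  have hc : Fintype.card {i // s i = n / m + 1} = Fintype.card {i // s' i = n / m + 1} := by
    rw [Fintype.card_subtype, Fintype.card_subtype, a2, b2]
  let e := Fintype.equivOfCardEq hc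
  refine ⟨e.extendSubtype, fun k => ?_⟩
  by_cases hk : s k = n / m + 1
  · rw [hk]; exact e.extendSubtype_mem k hk
  · have := e.extendSubtype_not_mem k hk
    rcases a1 k with h | h
    · rw [h]
      rcases b1 (e.extendSubtype k) with h' | h'
      · exact h'
      · exact absurd h' this
    · exact absurd h hk

open Filter Topology Matrix

/-- cone limits -/
def InCone {n : ℕ} (B N : Matrix (Fin n) (Fin n) ℂ) : Prop :=
  ∀ U ∈ 𝓝 N, ∀ᶠ τ : ℝ in 𝓝[>] 0, ∃ A, SameClass A B ∧ ((τ : ℂ) ^ 2) • A ∈ U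

/-- universal cone limits -/
def Ty {n : ℕ} (m : ℕ) (N : Matrix (Fin n) (Fin n) ℂ) : Prop :=
  ∀ B : Matrix (Fin n) (Fin n) ℂ, (∀ μ : ℂ, n ≤ (B - μ • (1 : Matrix (Fin n) (Fin n) ℂ)).rank + m) → InCone B N

lemma InCone_of_closure {n : ℕ} {B N : Matrix (Fin n) (Fin n) ℂ}
    (h : N ∈ closure {N' | InCone B N'}) : InCone B N := by
  intro U hU
  obtain ⟨O, hOU, hO, hNO⟩ := mem_nhds_iff.1 hU
  obtain ⟨N', h1, h2⟩ := mem_closure_iff.1 h O hO hNO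
  exact (h2 O (hO.mem_nhds h1)).mono (fun τ ⟨A, hA, hA2⟩ => ⟨A, hA, hOU hA2⟩)

lemma Ty_of_closure {n m : ℕ} {N : Matrix (Fin n) (Fin n) ℂ}
    (h : N ∈ closure {N' | Ty m N'}) : Ty m N := by
  intro B hB
  apply InCone_of_closure
  refine closure_mono ?_ h
  intro N' hN'
  exact hN' B hB

lemma Ty_mono {n m m' : ℕ} {N : Matrix (Fin n) (Fin n) ℂ} (hmm : m' ≤ m) (h : Ty m N) : Ty m' N :=
  fun B hB => h B (fun μ => (hB μ).trans (by omega))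

lemma sameClass_conj {n : ℕ} (B : Matrix (Fin n) (Fin n) ℂ) (T : (Fin n → ℂ) ≃ₗ[ℂ] (Fin n → ℂ)) :
    SameClass (LinearMap.toMatrix' (T.toLinearMap ∘ₗ B.mulVecLin ∘ₗ T.symm.toLinearMap)) B := by
  have h1 : LinearMap.toMatrix' T.toLinearMap * LinearMap.toMatrix' T.symm.toLinearMap = 1 := by
    rw [← LinearMap.toMatrix'_comp]
    simp
  have hu : IsUnit (LinearMap.toMatrix' T.toLinearMap) := by
    rw [Matrix.isUnit_iff_isUnit_det]
    exact Matrix.isUnit_det_of_right_inverse h1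
  refine ⟨LinearMap.toMatrix' T.toLinearMap, hu, ?_⟩
  rw [Matrix.inv_eq_right_inv h1, LinearMap.toMatrix'_comp, LinearMap.toMatrix'_comp,
    ← Matrix.toLin'_apply', LinearMap.toMatrix'_toLin', Matrix.mul_assoc]

lemma tendsto_of_basis {n : ℕ} {I : Type*} [Fintype I] (c : Module.Basis I ℂ (Fin n → ℂ))
    {A : ℝ → Matrix (Fin n) (Fin n) ℂ} {N : Matrix (Fin n) (Fin n) ℂ} {F : Filter ℝ}
    (h : ∀ y, Tendsto (fun τ => A τ *ᵥ c y) F (𝓝 (N *ᵥ c y))) : Tendsto A F (𝓝 N) := by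
  have key : ∀ M : Matrix (Fin n) (Fin n) ℂ, ∀ i j,
      M i j = ∑ y, c.repr (Pi.single j 1) y * (M *ᵥ c y) i := by
    intro M i j
    have h1 : M *ᵥ (Pi.single j 1) = ∑ y, c.repr (Pi.single j 1) y • (M *ᵥ c y) := by
      conv_lhs => rw [← c.sum_repr (Pi.single j 1)]
      rw [← Matrix.mulVecLin_apply, map_sum]
      simp
    have h2 := congrFun h1 i
    rw [Matrix.mulVec_single_one] at h2
    simpa using h2
  refine tendsto_pi_nhds.2 ?_
  intro i
  refine tendsto_pi_nhds.2 ?_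
  intro j
  rw [key N i j]
  simp_rw [fun τ => key (A τ) i j]
  apply tendsto_finsetSum
  intro y _
  exact ((tendsto_pi_nhds.1 (h y)) i).const_mul _

lemma limit_core {n m : ℕ} (s : Fin m → ℕ) (hbal : ∀ i j, s i ≤ s j + 1)
    (B N : Matrix (Fin n) (Fin n) ℂ)
    (b c : Module.Basis (Σ k, Fin (s k)) ℂ (Fin n → ℂ))
    (hb : ∀ k l (h : l + 1 < s k), B *ᵥ b ⟨k, ⟨l, by omega⟩⟩ = b ⟨k, ⟨l + 1, h⟩⟩)
    (hc : ∀ k l (h : l + 1 < s k), N *ᵥ c ⟨k, ⟨l, by omega⟩⟩ = c ⟨k, ⟨l + 1, h⟩⟩)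
    (hend : ∀ k l (h : l < s k), l + 1 = s k → N *ᵥ c ⟨k, ⟨l, h⟩⟩ = 0) : InCone B N := by
  classical
  let δ : Fin m → ℕ := fun k => if ∃ j, s k < s j then 1 else 0
  let w : (Σ k, Fin (s k)) → ℕ := fun x => 2 * (x.2 : ℕ) + δ x.1
  have hw : ∀ x y : (Σ k, Fin (s k)), (y.2 : ℕ) + 1 = s y.1 → w x + 1 ≤ 2 + w y := by
    rintro ⟨j, l⟩ ⟨k, l'⟩ h
    simp only [w, δ] at h ⊢
    have hl := l.2
    have h1 := hbal j k
    split_ifs with h2 h3 h3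
    · obtain ⟨i, hi⟩ := h2
      have := hbal i k
      omega
    · have : s j ≤ s k := by
        by_contra hh; exact h3 ⟨j, by omega⟩
      obtain ⟨i, hi⟩ := h2
      have : s i ≤ s k := by
        by_contra hh; exact h3 ⟨i, by omega⟩
      omega
    · omega
    · have : s j ≤ s k := by
        by_contra hh; exact h3 ⟨j, by omega⟩
      omega
  let u : ℝ → (Σ k, Fin (s k)) → ℂˣ := fun τ x =>
    if h : (τ : ℂ) = 0 then 1 else (Units.mk0 (τ : ℂ) h ^ (w x))⁻¹
  let T : ℝ → ((Fin n → ℂ) ≃ₗ[ℂ] (Fin n → ℂ)) := fun τ => b.equiv (c.unitsSMul (u τ)) (Equiv.refl _)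
  let A : ℝ → Matrix (Fin n) (Fin n) ℂ := fun τ =>
    LinearMap.toMatrix' ((T τ).toLinearMap ∘ₗ B.mulVecLin ∘ₗ (T τ).symm.toLinearMap)
  have hT : ∀ τ : ℝ, τ ≠ 0 → ∀ x, T τ (b x) = ((τ : ℂ) ^ w x)⁻¹ • c x := by
    intro τ hτ x
    have : (τ : ℂ) ≠ 0 := by exact_mod_cast hτ
    have hux : ((u τ x : ℂˣ) : ℂ) = ((τ : ℂ) ^ w x)⁻¹ := by
      simp only [u, dif_neg this]; simp
    simp only [T, Module.Basis.equiv_apply, Equiv.refl_apply, Module.Basis.unitsSMul_apply, Units.smul_def, hux]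
  have hTs : ∀ τ : ℝ, τ ≠ 0 → ∀ x, (T τ).symm (c x) = ((τ : ℂ) ^ w x) • b x := by
    intro τ hτ x
    have : (τ : ℂ) ≠ 0 := by exact_mod_cast hτ
    rw [LinearEquiv.symm_apply_eq, map_smul, hT τ hτ, smul_smul, mul_inv_cancel₀ (by positivity), one_smul]
  have hA : ∀ τ : ℝ, τ ≠ 0 → ∀ x, A τ *ᵥ c x = (τ : ℂ) ^ w x • T τ (B *ᵥ b x) := by
    intro τ hτ x
    rw [← Matrix.mulVecLin_apply, ← Matrix.toLin'_apply', Matrix.toLin'_toMatrix']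
    simp [hTs τ hτ, Matrix.mulVec_smul]
  have hlim : Tendsto (fun τ : ℝ => ((τ : ℂ) ^ 2) • A τ) (𝓝[>] 0) (𝓝 N) := by
    apply tendsto_of_basis c
    rintro ⟨k, l, hl⟩
    by_cases hlast : l + 1 < s k
    · apply tendsto_nhds_of_eventually_eq
      filter_upwards [self_mem_nhdsWithin] with τ hτ
      have hτ : τ ≠ 0 := ne_of_gt hτ
      have h0 : (τ : ℂ) ≠ 0 := by exact_mod_cast hτ
      rw [Matrix.smul_mulVec, hA τ hτ, hb k l hlast, hT τ hτ, hc k l hlast, smul_smul, smul_smul]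
      have : (τ : ℂ) ^ 2 * ((τ : ℂ) ^ w ⟨k, ⟨l, hl⟩⟩ * ((τ : ℂ) ^ w ⟨k, ⟨l + 1, hlast⟩⟩)⁻¹) = 1 := by
        have : w ⟨k, ⟨l + 1, hlast⟩⟩ = 2 + w ⟨k, ⟨l, hl⟩⟩ := by simp only [w]; ring
        rw [this, ← mul_assoc, ← pow_add]
        exact mul_inv_cancel₀ (pow_ne_zero _ h0)
      rw [← mul_assoc] at this
      rw [this, one_smul]
    · have hl1 : l + 1 = s k := by omega
      rw [hend k l hl hl1]
      set y : (Σ k, Fin (s k)) := ⟨k, ⟨l, hl⟩⟩ with hy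
      have hEq : ∀ᶠ τ : ℝ in 𝓝[>] 0, ∑ x, (b.repr (B *ᵥ b y) x * (τ : ℂ) ^ (2 + w y - w x)) • c x
          = (((τ : ℂ) ^ 2) • A τ) *ᵥ c y := by
        filter_upwards [self_mem_nhdsWithin] with τ hτ
        have hτ : τ ≠ 0 := ne_of_gt hτ
        have h0 : (τ : ℂ) ≠ 0 := by exact_mod_cast hτ
        rw [Matrix.smul_mulVec, hA τ hτ, smul_smul, ← pow_add]
        conv_rhs => rw [← b.sum_repr (B *ᵥ b y)]
        rw [map_sum, Finset.smul_sum]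
        apply Finset.sum_congr rfl
        intro x _
        rw [map_smul, hT τ hτ, smul_smul, smul_smul]
        congr 1
        have hwx := hw x y hl1
        rw [← Nat.sub_add_cancel (show w x ≤ 2 + w y by omega), pow_add, Nat.add_sub_cancel]
        field_simp
      refine Tendsto.congr' hEq ?_
      have hc0 : Continuous (fun τ : ℝ => ∑ x, (b.repr (B *ᵥ b y) x * (τ : ℂ) ^ (2 + w y - w x)) • c x) := by
        fun_prop
      have h1 := (hc0.tendsto 0).mono_left (nhdsWithin_le_nhds (s := Set.Ioi (0:ℝ)))
      convert h1 using 2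
      symm
      apply Finset.sum_eq_zero
      intro x _
      have hwx := hw x y hl1
      rw [Complex.ofReal_zero, zero_pow (by omega), mul_zero, zero_smul]
  intro U hU
  exact (hlim.eventually hU).mono (fun τ hτ => ⟨A τ, sameClass_conj B (T τ), hτ⟩)

lemma cone_of_chains {n m : ℕ} {ι : Type*} [Fintype ι] (hm : Fintype.card ι = m)
    (N : Matrix (Fin n) (Fin n) ℂ) (s : ι → ℕ) (c : ι → ℕ → (Fin n → ℂ))
    (hsum : ∑ k, s k = n) (hbal : ∀ i j, s i ≤ s j + 1)
    (hstep : ∀ k l, l + 1 < s k → N *ᵥ c k l = c k (l + 1))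
    (hend : ∀ k l, l + 1 = s k → N *ᵥ c k l = 0)
    (hspan : ∀ W : Submodule ℂ (Fin n → ℂ), (∀ k l, l < s k → c k l ∈ W) → W = ⊤) : Ty m N := by
  classical
  intro B hB
  obtain ⟨s0, v, hsp, hbal0, hli⟩ := exists_min_chain (B.mulVecLin) m (by
    intro μ
    have := hB μ
    rw [Module.finrank_fin_fun]
    have h2 : (B.mulVecLin - algebraMap ℂ (Module.End ℂ (Fin n → ℂ)) μ) =
        (B - μ • (1 : Matrix (Fin n) (Fin n) ℂ)).mulVecLin := by
      apply LinearMap.ext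
      intro x
      simp [Matrix.sub_mulVec, Matrix.smul_mulVec, Module.algebraMap_end_apply]
    rw [h2]
    exact this)
  let b : Module.Basis (Σ k, Fin (s0 k)) ℂ (Fin n → ℂ) := Module.Basis.mk hli (by
    rw [← hsp]
    apply Submodule.span_le.2
    rintro x ⟨k, l, hl, rfl⟩
    exact Submodule.subset_span ⟨⟨k, ⟨l, hl⟩⟩, rfl⟩)
  let e : Fin m ≃ ι := (Fintype.equivFinOfCardEq hm).symm
  have hsum0 : ∑ k, s0 k = n := by
    have := Module.finrank_eq_card_basis b
    simp at this
    exact this.symm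
  obtain ⟨σ, hσ⟩ := balanced_perm s0 (fun k => s (e k)) hbal0 (fun i j => hbal _ _) (by
    rw [hsum0, ← hsum]
    exact (e.sum_comp s).symm)
  let cf : (Σ k, Fin (s0 k)) → (Fin n → ℂ) := fun x => c (e (σ x.1)) x.2
  have hcs : ⊤ ≤ Submodule.span ℂ (Set.range cf) := by
    rw [hspan (Submodule.span ℂ (Set.range cf))]
    intro k l hl
    obtain ⟨k', rfl⟩ := (σ.trans e).surjective k
    have hl' : l < s0 k' := by rw [← hσ k']; exact hl
    exact Submodule.subset_span ⟨⟨k', ⟨l, hl'⟩⟩, rfl⟩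
  let cb : Module.Basis (Σ k, Fin (s0 k)) ℂ (Fin n → ℂ) :=
    basisOfTopLeSpanOfCardEqFinrank cf hcs (by simp [hsum0])
  have hcb : ∀ x, cb x = cf x := by intro x; simp [cb]
  have hbb : ∀ x : (Σ k, Fin (s0 k)), b x = ((B.mulVecLin) ^ (x.2 : ℕ)) (v x.1) := by intro x; simp [b]
  apply limit_core s0 hbal0 B N b cb
  · intro k l h
    rw [hbb, hbb, pow_succ', Module.End.mul_apply, Matrix.mulVecLin_apply]
  · intro k l h
    rw [hcb, hcb]
    exact hstep _ _ (by rw [hσ]; exact h)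
  · intro k l h h'
    rw [hcb]
    exact hend _ _ (by rw [hσ]; exact h')

section Irr

/-- word products -/
def wordProd {n q : ℕ} (A : Fin q → Matrix (Fin n) (Fin n) ℂ) : List (Fin q) → Matrix (Fin n) (Fin n) ℂ
  | [] => 1
  | j :: w => A j * wordProd A w

lemma wordProd_cont {n q : ℕ} (w : List (Fin q)) :
    Continuous (fun A : Fin q → Matrix (Fin n) (Fin n) ℂ => wordProd A w) := by
  induction w with
  | nil => exact continuous_const
  | cons j w ih => exact (continuous_apply j).matrix_mul ih

lemma irr_word {n q : ℕ} {N : Fin q → Matrix (Fin n) (Fin n) ℂ} (hN : IrreducibleTuple N)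
    (v φ : Fin n → ℂ) (hv : v ≠ 0) (hφ : φ ≠ 0) : ∃ w, φ ⬝ᵥ (wordProd N w *ᵥ v) ≠ 0 := by
  by_contra hcon
  push Not at hcon
  let W := Submodule.span ℂ (Set.range (fun w => wordProd N w *ᵥ v))
  have hvW : v ∈ W := Submodule.subset_span ⟨[], by simp [wordProd]⟩
  rcases hN W (by
    intro j x hx
    have : W ≤ Submodule.comap (N j).mulVecLin W := by
      apply Submodule.span_le.2
      rintro _ ⟨w, rfl⟩
      apply Submodule.subset_span
      exact ⟨j :: w, by simp [wordProd]⟩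
    exact this hx) with h | h
  · rw [h] at hvW
    exact hv (by simpa using hvW)
  · apply hφ
    have hle : ∀ x ∈ W, φ ⬝ᵥ x = 0 := by
      intro x hx
      induction hx using Submodule.span_induction with
      | mem x hx => obtain ⟨w, rfl⟩ := hx; exact hcon w
      | zero => simp
      | add x y _ _ hx hy => rw [dotProduct_add, hx, hy, add_zero]
      | smul a x _ hx => rw [dotProduct_smul, hx, smul_zero]
    ext i
    have := hle (Pi.single i 1) (by rw [h]; trivial)
    simpa using this

lemma irr_open {n q : ℕ} {N : Fin q → Matrix (Fin n) (Fin n) ℂ} (hN : IrreducibleTuple N) :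
    ∀ᶠ A in 𝓝 N, IrreducibleTuple A := by
  have hK : IsCompact ((Metric.sphere (0 : Fin n → ℂ) 1) ×ˢ (Metric.sphere (0 : Fin n → ℂ) 1)) :=
    (isCompact_sphere _ _).prod (isCompact_sphere _ _)
  have key : ∀ᶠ A in 𝓝 N, ∀ y ∈ ((Metric.sphere (0 : Fin n → ℂ) 1) ×ˢ (Metric.sphere (0 : Fin n → ℂ) 1)),
      ∃ w, y.2 ⬝ᵥ (wordProd A w *ᵥ y.1) ≠ 0 := by
    apply hK.eventually_forall_of_forall_eventually
    rintro ⟨v, φ⟩ ⟨hv, hφ⟩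
    obtain ⟨w, hw⟩ := irr_word hN v φ (by rintro rfl; simp at hv) (by rintro rfl; simp at hφ)
    have hc : Continuous (fun z : (Fin q → Matrix (Fin n) (Fin n) ℂ) × ((Fin n → ℂ) × (Fin n → ℂ)) =>
        z.2.2 ⬝ᵥ (wordProd z.1 w *ᵥ z.2.1)) := by
      have h1 := (wordProd_cont (n := n) w).comp (continuous_fst (X := Fin q → Matrix (Fin n) (Fin n) ℂ)
        (Y := (Fin n → ℂ) × (Fin n → ℂ)))
      exact (continuous_snd.comp continuous_snd).dotProduct (h1.matrix_mulVec (continuous_fst.comp continuous_snd))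
    have := hc.continuousAt (x := (N, (v, φ))) |>.eventually_ne hw
    exact this.mono (fun z hz => ⟨w, hz⟩)
  refine key.mono (fun A hA W hW => ?_)
  by_contra hcon
  push Not at hcon
  obtain ⟨hb, ht⟩ := hcon
  obtain ⟨v, hvW, hv⟩ := Submodule.exists_mem_ne_zero_of_ne_bot hb
  obtain ⟨f, hf, hfW⟩ := Submodule.exists_le_ker_of_lt_top W (lt_top_iff_ne_top.2 ht)
  let φ : Fin n → ℂ := fun i => f (Pi.single i 1)
  have hφf : ∀ x, φ ⬝ᵥ x = f x := by
    intro x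
    conv_rhs => rw [← Finset.univ_sum_single x]
    rw [map_sum, dotProduct]
    apply Finset.sum_congr rfl
    intro i _
    have : (Pi.single i (x i) : Fin n → ℂ) = x i • Pi.single i 1 := by
      rw [← Pi.single_smul]; simp
    rw [this, map_smul, smul_eq_mul, mul_comm]
  have hφ : φ ≠ 0 := by
    intro h
    apply hf
    ext i
    have := congrFun h i
    simpa [φ] using this
  have hnv : ‖v‖ ≠ 0 := norm_ne_zero_iff.2 hv
  have hnφ : ‖φ‖ ≠ 0 := norm_ne_zero_iff.2 hφ
  obtain ⟨w, hw⟩ := hA ((‖v‖⁻¹ : ℂ) • v, (‖φ‖⁻¹ : ℂ) • φ) ⟨by simp [norm_smul, hnv], by simp [norm_smul, hnφ]⟩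
  apply hw
  have hwW : ∀ w, wordProd A w *ᵥ v ∈ W := by
    intro w
    induction w with
    | nil => simpa [wordProd] using hvW
    | cons j w ih => 
      rw [wordProd, ← Matrix.mulVec_mulVec]
      exact hW j _ ih
  have h1 : f (wordProd A w *ᵥ v) = 0 := hfW (hwW w)
  simp only [smul_dotProduct, Matrix.mulVec_smul, dotProduct_smul, hφf, h1, smul_zero]

lemma irr_smul {n q : ℕ} {A : Fin q → Matrix (Fin n) (Fin n) ℂ} (hA : IrreducibleTuple A) (c : ℂ) (hc : c ≠ 0) :
    IrreducibleTuple (fun j => c • A j) := by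
  intro W hW
  apply hA W
  intro j v hv
  have := W.smul_mem c⁻¹ (hW j v hv)
  rwa [Matrix.smul_mulVec, smul_smul, inv_mul_cancel₀ hc, one_smul] at this

lemma schur {n q : ℕ} (hn : 0 < n) {N : Fin q → Matrix (Fin n) (Fin n) ℂ} (hN : IrreducibleTuple N)
    (Z : Matrix (Fin n) (Fin n) ℂ) (hZ : ∀ j, Z * N j = N j * Z) : ∃ c : ℂ, Z = c • (1 : Matrix (Fin n) (Fin n) ℂ) := by
  haveI : Nonempty (Fin n) := ⟨⟨0, hn⟩⟩
  obtain ⟨μ, hμ⟩ := Module.End.exists_eigenvalue (Matrix.toLin' Z)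
  refine ⟨μ, ?_⟩
  rcases hN (Module.End.eigenspace (Matrix.toLin' Z) μ) (by
    intro j v hv
    rw [Module.End.mem_eigenspace_iff, Matrix.toLin'_apply] at hv ⊢
    rw [Matrix.mulVec_mulVec, hZ, ← Matrix.mulVec_mulVec, hv, Matrix.mulVec_smul]) with h | h
  · exact absurd h hμ
  · apply Matrix.toLin'.injective
    apply LinearMap.ext
    intro x
    have : x ∈ Module.End.eigenspace (Matrix.toLin' Z) μ := by rw [h]; trivial
    rw [Module.End.mem_eigenspace_iff] at this
    rw [this]
    simp [Matrix.smul_mulVec]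

lemma surj_bracket {n q : ℕ} (hn : 0 < n) {N : Fin q → Matrix (Fin n) (Fin n) ℂ} (hN : IrreducibleTuple N)
    (Y : Matrix (Fin n) (Fin n) ℂ) : ∃ (X : Fin q → Matrix (Fin n) (Fin n) ℂ) (c : ℂ),
      ∑ j, (X j * N j - N j * X j) + c • (1 : Matrix (Fin n) (Fin n) ℂ) = Y := by
  let L : ((Fin q → Matrix (Fin n) (Fin n) ℂ) × ℂ) →ₗ[ℂ] Matrix (Fin n) (Fin n) ℂ :=
    { toFun := fun x => ∑ j, (x.1 j * N j - N j * x.1 j) + x.2 • (1 : Matrix (Fin n) (Fin n) ℂ)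
      map_add' := by
        intro x y
        have : ∀ j, ((x + y).1 j * N j - N j * (x + y).1 j) =
          (x.1 j * N j - N j * x.1 j) + (y.1 j * N j - N j * y.1 j) := by
          intro j
          simp only [Prod.fst_add, Pi.add_apply, Matrix.add_mul, Matrix.mul_add]
          abel
        rw [Finset.sum_congr rfl (fun j _ => this j), Finset.sum_add_distrib, Prod.snd_add, add_smul]
        abel
      map_smul' := by
        intro a x
        simp [Finset.smul_sum, smul_sub, mul_smul] }
  suffices hL : LinearMap.range L = ⊤ by
    have : Y ∈ LinearMap.range L := by rw [hL]; trivial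
    obtain ⟨x, hx⟩ := this
    exact ⟨x.1, x.2, hx⟩
  by_contra hne
  obtain ⟨f, hf, hfW⟩ := Submodule.exists_le_ker_of_lt_top _ (lt_top_iff_ne_top.2 hne)
  let Z : Matrix (Fin n) (Fin n) ℂ := Matrix.of fun i j => f (Matrix.single j i 1)
  have hfZ : ∀ M, f M = (Z * M).trace := by
    intro M
    conv_lhs => rw [Matrix.matrix_eq_sum_single M]
    simp only [map_sum, Matrix.trace, Matrix.diag_apply, Matrix.mul_apply]
    rw [Finset.sum_comm]
    apply Finset.sum_congr rfl
    intro i _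
    apply Finset.sum_congr rfl
    intro j _
    have : Matrix.single j i (M j i) = M j i • Matrix.single j i (1:ℂ) := by simp
    rw [this, map_smul]
    simp [Z, mul_comm]
  have hZ : ∀ j, Z * N j = N j * Z := by
    intro j
    have h1 : ∀ X, ((N j * Z - Z * N j) * X).trace = 0 := by
      intro X
      have h2 : f (L (Pi.single j X, 0)) = 0 := hfW ⟨_, rfl⟩
      have h3 : L (Pi.single j X, 0) = X * N j - N j * X := by
        change ∑ j', ((Pi.single j X : Fin q → Matrix (Fin n) (Fin n) ℂ) j' * N j' - N j' * (Pi.single j X : Fin q → Matrix (Fin n) (Fin n) ℂ) j') + (0:ℂ) • (1 : Matrix (Fin n) (Fin n) ℂ) = _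
        rw [Finset.sum_eq_single j]
        · simp
        · intro b _ hb
          simp [hb]
        · simp
      rw [h3, hfZ, Matrix.mul_sub, Matrix.trace_sub, ← Matrix.mul_assoc, Matrix.trace_mul_comm (Z * X) (N j),
        ← Matrix.mul_assoc, ← Matrix.mul_assoc] at h2
      rw [Matrix.sub_mul, Matrix.trace_sub]
      exact h2
    have h4 : N j * Z - Z * N j = 0 := by
      apply Matrix.ext_iff_trace_mul_right.2
      intro X
      rw [h1 X]; simp
    exact (sub_eq_zero.1 h4).symm
  obtain ⟨c, hc⟩ := schur hn hN Z hZ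
  have h5 : f (L (0, 1)) = 0 := hfW ⟨_, rfl⟩
  have h6 : L (0, 1) = 1 := by
    change ∑ j', ((0 : Fin q → Matrix (Fin n) (Fin n) ℂ) j' * N j' - N j' * (0 : Fin q → Matrix (Fin n) (Fin n) ℂ) j') + (1:ℂ) • (1 : Matrix (Fin n) (Fin n) ℂ) = _
    simp
  rw [h6, hfZ, hc] at h5
  simp at h5
  rcases h5 with h5 | h5
  · apply hf
    apply LinearMap.ext
    intro M
    rw [hfZ, hc, h5]
    simp
  · omega
end Irr

section Deform
open scoped Matrix.Norms.Operator

section Abs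
variable {R : Type} [NormedRing R] [NormedAlgebra ℂ R] [CompleteSpace R]

/-- the deformation map -/
noncomputable def hmap {q : ℕ} (x : (Fin q → R) × (Fin q → R) × ℂ) : R × (Fin q → R) :=
  (∑ j, (1 + x.1 j) * x.2.1 j * Ring.inverse (1 + x.1 j) + x.2.2 • (1 : R), x.2.1)

lemma hmap_nhds {q : ℕ} {N : Fin q → R}
    (hsurj : ∀ Y : R, ∃ (X : Fin q → R) (c : ℂ), ∑ j, (X j * N j - N j * X j) + c • (1 : R) = Y)
    (hsum : ∑ j, N j = 0) :
    Filter.map (hmap (R := R) (q := q)) (𝓝 (0, N, 0)) = 𝓝 (0, N) := by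
  let x0 : (Fin q → R) × (Fin q → R) × ℂ := (0, N, 0)
  let pX : Fin q → ((Fin q → R) × (Fin q → R) × ℂ →L[ℂ] R) := fun j =>
    (ContinuousLinearMap.proj j).comp (ContinuousLinearMap.fst ℂ _ _)
  let pM : Fin q → ((Fin q → R) × (Fin q → R) × ℂ →L[ℂ] R) := fun j =>
    (ContinuousLinearMap.proj j).comp ((ContinuousLinearMap.fst ℂ _ _).comp (ContinuousLinearMap.snd ℂ _ _))
  let pc : (Fin q → R) × (Fin q → R) × ℂ →L[ℂ] ℂ := (ContinuousLinearMap.snd ℂ _ _).comp (ContinuousLinearMap.snd ℂ _ _)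
  let pN : (Fin q → R) × (Fin q → R) × ℂ →L[ℂ] (Fin q → R) := (ContinuousLinearMap.fst ℂ _ _).comp (ContinuousLinearMap.snd ℂ _ _)
  have hX : ∀ j, HasStrictFDerivAt (fun x : (Fin q → R) × (Fin q → R) × ℂ => 1 + x.1 j) (pX j) x0 := fun j =>
    ((pX j).hasStrictFDerivAt (x := x0)).const_add 1
  have hM : ∀ j, HasStrictFDerivAt (fun x : (Fin q → R) × (Fin q → R) × ℂ => x.2.1 j) (pM j) x0 := fun j =>
    (pM j).hasStrictFDerivAt (x := x0)
  have hI : ∀ j, HasStrictFDerivAt (fun x : (Fin q → R) × (Fin q → R) × ℂ => Ring.inverse (1 + x.1 j)) (-(pX j)) x0 := by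
    intro j
    have h0 : (1 : R) + x0.1 j = ((1 : Rˣ) : R) := by
      simp [x0]
    have h1 := hasStrictFDerivAt_ringInverse (𝕜 := ℂ) (R := R) 1
    rw [← h0] at h1
    have h2 := h1.comp x0 (hX j)
    have h3 : (-((ContinuousLinearMap.mulLeftRight ℂ R) ((1 : Rˣ)⁻¹ : Rˣ)) ((1 : Rˣ)⁻¹ : Rˣ)).comp (pX j) = -(pX j) := by
      apply ContinuousLinearMap.ext
      intro y
      simp
    rw [h3] at h2
    exact h2
  have hterm : ∀ j, HasStrictFDerivAt (fun x : (Fin q → R) × (Fin q → R) × ℂ => (1 + x.1 j) * x.2.1 j * Ring.inverse (1 + x.1 j)) _ x0 :=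
    fun j => ((hX j).mul' (hM j)).mul' (hI j)
  have hc : HasStrictFDerivAt (fun x : (Fin q → R) × (Fin q → R) × ℂ => x.2.2 • (1 : R)) (pc.smulRight 1) x0 :=
    (pc.smulRight (1 : R)).hasStrictFDerivAt (x := x0)
  have hsumd := (HasStrictFDerivAt.fun_sum (u := Finset.univ) (fun j _ => hterm j)).add hc
  have hM2 : HasStrictFDerivAt (fun x : (Fin q → R) × (Fin q → R) × ℂ => x.2.1) pN x0 :=
    pN.hasStrictFDerivAt (x := x0)
  have hall := hsumd.prodMk hM2
  have hh : hmap x0 = (0, N) := by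
    simp [hmap, x0, hsum]
  have hsurj := hall.map_nhds_eq_of_surj (by
    rw [LinearMap.range_eq_top]
    rintro ⟨Y, M⟩
    obtain ⟨X, c, hXc⟩ := hsurj (Y - ∑ j, M j)
    refine ⟨(X, M, c), ?_⟩
    apply Prod.ext
    · have : Y = (∑ j, (X j * N j - N j * X j) + c • (1 : R)) + ∑ j, M j := by
        rw [hXc]; abel
      rw [this]
      simp [x0, pX, pM, pc, Finset.sum_add_distrib, Finset.sum_sub_distrib]
      abel
    · rfl)
  change Filter.map (fun x : (Fin q → R) × (Fin q → R) × ℂ => ((∑ j, (1 + x.1 j) * x.2.1 j * Ring.inverse (1 + x.1 j) + x.2.2 • (1 : R), x.2.1) : R × (Fin q → R))) (𝓝 x0) = _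
  rw [← hh]
  exact hsurj

lemma deform_abs {q : ℕ} {N : Fin q → R}
    (hsurj : ∀ Y : R, ∃ (X : Fin q → R) (c : ℂ), ∑ j, (X j * N j - N j * X j) + c • (1 : R) = Y)
    (hsum : ∑ j, N j = 0) (P : (Fin q → R) → Prop) (hP : ∀ᶠ M in 𝓝 N, P M) :
    ∀ᶠ M in 𝓝 N, ∃ (S : Fin q → R) (c : ℂ), (∀ j, IsUnit (S j)) ∧
      ∑ j, S j * M j * Ring.inverse (S j) + c • (1 : R) = 0 ∧
      P (fun j => S j * M j * Ring.inverse (S j)) := by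
  have h1 : ∀ᶠ x : (Fin q → R) × (Fin q → R) × ℂ in 𝓝 (0, N, 0), ∀ j, IsUnit (1 + x.1 j) := by
    rw [eventually_all]
    intro j
    have hcont : ContinuousAt (fun x : (Fin q → R) × (Fin q → R) × ℂ => 1 + x.1 j) (0, N, 0) := by fun_prop
    apply hcont.eventually
    apply Units.isOpen.mem_nhds
    simp
  have h2 : ∀ᶠ x : (Fin q → R) × (Fin q → R) × ℂ in 𝓝 (0, N, 0), P (fun j => (1 + x.1 j) * x.2.1 j * Ring.inverse (1 + x.1 j)) := by
    have hcont : ContinuousAt (fun x : (Fin q → R) × (Fin q → R) × ℂ => fun j => (1 + x.1 j) * x.2.1 j * Ring.inverse (1 + x.1 j)) (0, N, 0) := by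
      rw [continuousAt_pi]
      intro j
      have hi : ContinuousAt (fun x : (Fin q → R) × (Fin q → R) × ℂ => Ring.inverse (1 + x.1 j)) (0, N, 0) := by
        have hc1 : ContinuousAt (fun x : (Fin q → R) × (Fin q → R) × ℂ => 1 + x.1 j) (0, N, 0) := by fun_prop
        have := NormedRing.inverse_continuousAt (1 : Rˣ)
        refine ContinuousAt.comp (g := Ring.inverse) ?_ hc1
        convert this
        simp
      refine ContinuousAt.mul ?_ hi
      fun_prop
    apply hcont.eventually
    simpa using hP
  have h3 : hmap '' {x : (Fin q → R) × (Fin q → R) × ℂ | (∀ j, IsUnit (1 + x.1 j)) ∧ P (fun j => (1 + x.1 j) * x.2.1 j * Ring.inverse (1 + x.1 j))} ∈ 𝓝 ((0 : R), N) := by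
    rw [← hmap_nhds hsurj hsum]
    exact Filter.image_mem_map (h1.and h2)
  have hc : ContinuousAt (fun M : Fin q → R => ((0 : R), M)) N := by fun_prop
  filter_upwards [hc h3] with M hM
  obtain ⟨x, ⟨hx1, hx2⟩, hx⟩ := hM
  have e1 : x.2.1 = M := congrArg Prod.snd hx
  have e2 := congrArg Prod.fst hx
  refine ⟨fun j => 1 + x.1 j, x.2.2, hx1, ?_, ?_⟩
  · simp only [hmap, e1] at e2
    exact e2
  · rw [e1] at hx2
    exact hx2
end Abs

lemma deform_local {n q : ℕ} (hn : 0 < n) {N : Fin q → Matrix (Fin n) (Fin n) ℂ} (hN : IrreducibleTuple N)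
    (hsum : ∑ j, N j = 0) :
    ∀ᶠ M in 𝓝 N, ∃ (S : Fin q → Matrix (Fin n) (Fin n) ℂ) (c : ℂ), (∀ j, IsUnit (S j)) ∧
      ∑ j, S j * M j * (S j)⁻¹ + c • (1 : Matrix (Fin n) (Fin n) ℂ) = 0 ∧
      IrreducibleTuple (fun j => S j * M j * (S j)⁻¹) := by
  have : CompleteSpace (Matrix (Fin n) (Fin n) ℂ) := FiniteDimensional.complete ℂ _
  have := deform_abs (surj_bracket hn hN) hsum IrreducibleTuple (irr_open hN)
  simp only [Matrix.nonsing_inv_eq_ringInverse]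
  exact this

end Deform

lemma deform {n q : ℕ} (hn : 0 < n) {B N : Fin q → Matrix (Fin n) (Fin n) ℂ} (hN : IrreducibleTuple N)
    (hsum : ∑ j, N j = 0) (hcone : ∀ j, InCone (B j) (N j)) (htr : ∑ j, (B j).trace = 0) :
    ∃ A : Fin q → Matrix (Fin n) (Fin n) ℂ,
      (∀ j, SameClass (A j) (B j)) ∧ ∑ j, A j = 0 ∧ IrreducibleTuple A := by
  have hloc := deform_local hn hN hsum
  rw [nhds_pi, Filter.Eventually, Filter.mem_pi] at hloc
  obtain ⟨I, _, U, hU, hsub⟩ := hloc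
  have hev : ∀ᶠ τ : ℝ in 𝓝[>] 0, ∀ j, ∃ A, SameClass A (B j) ∧ ((τ : ℂ) ^ 2) • A ∈ U j :=
    eventually_all.2 (fun j => hcone j (U j) (hU j))
  obtain ⟨τ, hτ, hτ0⟩ := (hev.and self_mem_nhdsWithin).exists
  have hτ1 : ((τ : ℂ) ^ 2) ≠ 0 := by
    have : τ ≠ 0 := ne_of_gt hτ0
    exact pow_ne_zero _ (by exact_mod_cast this)
  choose A hA hAU using hτ
  obtain ⟨S, c, hS, hs0, hirr⟩ := hsub (show (fun j => ((τ : ℂ) ^ 2) • A j) ∈ I.pi U from fun j _ => hAU j)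
  have htrS : ∀ (S M : Matrix (Fin n) (Fin n) ℂ), IsUnit S → (S * M * S⁻¹).trace = M.trace := by
    intro S M hS
    rw [Matrix.trace_mul_comm, ← Matrix.mul_assoc, Matrix.nonsing_inv_mul _ ((Matrix.isUnit_iff_isUnit_det _).1 hS), Matrix.one_mul]
  have htrA : ∀ j, (A j).trace = (B j).trace := by
    intro j
    obtain ⟨P, hP, h⟩ := hA j
    rw [h, htrS P _ hP]
  have hc : c = 0 := by
    have := congrArg Matrix.trace hs0
    rw [Matrix.trace_add, Matrix.trace_sum] at this
    simp only [htrS _ _ (hS _), Matrix.trace_smul, htrA, ← Finset.smul_sum, htr] at this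
    simp at this
    rcases this with h | h
    · exact h
    · omega
  have hconj : ∀ j, S j * ((τ : ℂ) ^ 2 • A j) * (S j)⁻¹ = (τ : ℂ) ^ 2 • (S j * A j * (S j)⁻¹) := by
    intro j; simp
  refine ⟨fun j => S j * A j * (S j)⁻¹, ?_, ?_, ?_⟩
  · intro j
    obtain ⟨P, hP, h⟩ := hA j
    refine ⟨S j * P, (hS j).mul hP, ?_⟩
    simp only
    rw [h, Matrix.mul_inv_rev]
    simp only [Matrix.mul_assoc]
  · rw [hc, zero_smul, add_zero, Finset.sum_congr rfl (fun j _ => hconj j), ← Finset.smul_sum] at hs0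
    exact (smul_eq_zero.1 hs0).resolve_left hτ1
  · have := irr_smul hirr ((τ : ℂ) ^ 2)⁻¹ (inv_ne_zero hτ1)
    convert this using 1
    ext1 j
    simp only
    rw [hconj, smul_smul, inv_mul_cancel₀ hτ1, one_smul]

section Tools

lemma exists_dot {n : ℕ} (W : Submodule ℂ (Fin n → ℂ)) (h : W ≠ ⊤) :
    ∃ φ : Fin n → ℂ, φ ≠ 0 ∧ ∀ x ∈ W, φ ⬝ᵥ x = 0 := by
  obtain ⟨f, hf, hfW⟩ := Submodule.exists_le_ker_of_lt_top W (lt_top_iff_ne_top.2 h)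
  let φ : Fin n → ℂ := fun i => f (Pi.single i 1)
  have hφf : ∀ x, φ ⬝ᵥ x = f x := by
    intro x
    conv_rhs => rw [← Finset.univ_sum_single x]
    rw [map_sum, dotProduct]
    apply Finset.sum_congr rfl
    intro i _
    have : (Pi.single i (x i) : Fin n → ℂ) = x i • Pi.single i 1 := by
      rw [← Pi.single_smul]; simp
    rw [this, map_smul, smul_eq_mul, mul_comm]
  refine ⟨φ, ?_, fun x hx => by rw [hφf]; exact hfW hx⟩
  intro h
  apply hf
  ext i
  have := congrFun h i
  simpa [φ] using this

lemma Ty_bip {n ρ : ℕ} (N : Matrix (Fin n) (Fin n) ℂ) (L : Finset (Fin n)) (hL : L.card ≤ ρ)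
    (hL2 : 2 * L.card ≤ n) (hN : ∀ x y, N x y ≠ 0 → y ∈ L ∧ x ∉ L) : Ty (n - ρ) N := by
  classical
  apply Ty_mono (m := n - L.card) (by omega)
  have hcard : Fintype.card {x // x ∉ L} = n - L.card := by
    rw [Fintype.card_subtype_compl]; simp
  obtain ⟨g⟩ : Nonempty ({x // x ∈ L} ↪ {x // x ∉ L}) := by
    apply Function.Embedding.nonempty_of_card_le
    rw [hcard]; simp; omega
  let G : Matrix (Fin n) (Fin n) ℂ := fun x y => if h : y ∈ L then (if x = (g ⟨y, h⟩ : Fin n) then 1 else 0) else 0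
  let Q : Matrix {x // x ∈ L} {x // x ∈ L} ℂ := fun y' y => N (g y') y
  have hG : ∀ x y, G x y ≠ 0 → y ∈ L ∧ x ∉ L := by
    intro x y h
    simp only [G] at h
    split_ifs at h with h1 h2
    · exact ⟨h1, by rw [h2]; exact (g ⟨y, h1⟩).2⟩
    · simp at h
    · simp at h
  have hgood : ∀ ε : ℂ, (-Q).charpoly.eval ε ≠ 0 → Ty (n - L.card) (N + ε • G) := by
    intro ε hε
    set M := N + ε • G with hM
    have hMM : ∀ x y, M x y ≠ 0 → y ∈ L ∧ x ∉ L := by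
      intro x y h
      by_cases h1 : N x y = 0
      · by_cases h2 : G x y = 0
        · simp [hM, h1, h2] at h
        · exact hG x y h2
      · exact hN x y h1
    have hM0 : ∀ x, x ∉ L → M *ᵥ Pi.single x 1 = 0 := by
      intro x hx
      rw [Matrix.mulVec_single_one]
      ext z
      by_contra h
      exact hx (hMM z x h).1
    have hM2 : ∀ y, M *ᵥ (M *ᵥ Pi.single y 1) = 0 := by
      intro y
      rw [Matrix.mulVec_mulVec, Matrix.mulVec_single_one]
      ext z
      change (M * M) z y = 0
      rw [Matrix.mul_apply]
      apply Finset.sum_eq_zero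
      intro x _
      by_contra h
      have h1 := hMM z x (left_ne_zero_of_mul h)
      have h2 := hMM x y (right_ne_zero_of_mul h)
      exact h2.2 h1.1
    let s : {x // x ∉ L} → ℕ := fun k => if ∃ y, g y = k then 2 else 1
    let c : {x // x ∉ L} → ℕ → (Fin n → ℂ) := fun k l =>
      if h : ∃ y, g y = k then (if l = 0 then Pi.single (h.choose : Fin n) 1 else M *ᵥ Pi.single (h.choose : Fin n) 1)
      else Pi.single (k : Fin n) 1
    have hch : ∀ y (h : ∃ y', g y' = g y), h.choose = y := fun y h => g.injective h.choose_spec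
    apply cone_of_chains (ι := {x // x ∉ L}) hcard M s c
    · have : ∀ k, s k = 1 + if ∃ y, g y = k then 1 else 0 := by
        intro k; simp only [s]; split_ifs <;> rfl
      rw [Finset.sum_congr rfl (fun k _ => this k), Finset.sum_add_distrib, Finset.sum_boole]
      have h2 : (Finset.univ.filter (fun k => ∃ y, g y = k)) = Finset.univ.map g := by
        ext k; simp
      rw [h2, Finset.card_map]
      have h3 : (Finset.univ : Finset {x // x ∈ L}).card = L.card := by simp
      rw [h3, Finset.sum_const, Finset.card_univ, hcard]
      simp only [smul_eq_mul, mul_one, Nat.cast_id]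
      omega
    · intro i j
      simp only [s]; split_ifs <;> omega
    · intro k l hl
      simp only [s] at hl
      split_ifs at hl with h
      · have : l = 0 := by omega
        subst this
        simp only [c, dif_pos h, if_true, zero_add, one_ne_zero, if_false]
      · omega
    · intro k l hl
      simp only [s] at hl
      split_ifs at hl with h
      · have : l = 1 := by omega
        subst this
        simp only [c, dif_pos h]
        exact hM2 _
      · simp only [c, dif_neg h]
        exact hM0 _ k.2
    · intro W hW
      by_contra hne
      obtain ⟨φ, hφ, hφW⟩ := exists_dot W hne
      apply hφ
      have h1 : ∀ y : {x // x ∈ L}, φ y = 0 := by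
        intro y
        have hex : ∃ y', g y' = g y := ⟨y, rfl⟩
        have := hφW _ (hW (g y) 0 (by simp [s]))
        simp only [c, dif_pos hex, hch y hex] at this
        simpa using this
      have h2 : ∀ k : {x // x ∉ L}, (¬ ∃ y, g y = k) → φ k = 0 := by
        intro k hk
        have := hφW _ (hW k 0 (by simp only [s]; split_ifs; omega))
        simp only [c, dif_neg hk] at this
        simpa using this
      have h3 : ∀ y : {x // x ∈ L}, ∑ x, φ x * M x y = 0 := by
        intro y
        have hex : ∃ y', g y' = g y := ⟨y, rfl⟩
        have := hφW _ (hW (g y) 1 (by simp [s]))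
        simp only [c, dif_pos hex, hch y hex, one_ne_zero, if_false, Matrix.mulVec_single_one] at this
        exact this
      have h4 : ∀ y : {x // x ∈ L}, ∑ y', φ (g y') * M (g y') y = 0 := by
        intro y
        rw [← h3 y]
        apply Finset.sum_of_injOn (fun y' => ((g y' : {x // x ∉ L}) : Fin n))
        · intro a _ b _ hab
          exact g.injective (Subtype.ext hab)
        · intro a _; simp
        · intro x _ hx
          by_cases hxL : x ∈ L
          · rw [h1 ⟨x, hxL⟩, zero_mul]
          · rw [h2 ⟨x, hxL⟩, zero_mul]
            rintro ⟨y', hy'⟩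
            exact hx ⟨y', by simp, by simp [hy']⟩
        · intro a _; rfl
      have h5 : (fun y' => φ (g y')) ᵥ* (Matrix.scalar _ ε - (-Q)) = 0 := by
        ext y
        rw [Pi.zero_apply, ← h4 y, Matrix.vecMul, dotProduct]
        apply Finset.sum_congr rfl
        intro y' _
        congr 1
        have hGe : G (g y') y = if y' = y then 1 else 0 := by
          simp only [G, dif_pos y.2, Subtype.coe_eta]
          congr 1
          exact propext ⟨fun h => g.injective (Subtype.ext h), fun h => by rw [h]⟩
        change (Matrix.scalar _ ε) y' y - (-(N (g y') y)) = N (g y') y + ε * G (g y') y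
        rw [hGe, Matrix.scalar_apply, Matrix.diagonal_apply]
        split_ifs <;> simp [add_comm]
      have h6 := Matrix.eq_zero_of_vecMul_eq_zero (by rw [← Matrix.eval_charpoly]; exact hε) h5
      ext x
      by_cases hxL : x ∈ L
      · exact h1 ⟨x, hxL⟩
      · by_cases hk : ∃ y, g y = ⟨x, hxL⟩
        · obtain ⟨y, hy⟩ := hk
          have := congrFun h6 y
          simpa [hy] using this
        · exact h2 ⟨x, hxL⟩ hk
  apply Ty_of_closure
  have hdense : Dense ({ε : ℂ | (-Q).charpoly.eval ε ≠ 0}) := by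
    have hfin : Set.Finite {ε : ℂ | (-Q).charpoly.eval ε = 0} := by
      have := Polynomial.finite_setOfPred_isRoot (p := (-Q).charpoly) (Matrix.charpoly_monic _).ne_zero
      exact this
    have := Set.Countable.dense_compl ℂ hfin.countable
    exact this
  have hcont : Continuous (fun ε : ℂ => N + ε • G) := by fun_prop
  have := map_mem_closure hcont (hdense 0) (t := {N' | Ty (n - L.card) N'}) (fun ε hε => hgood ε hε)
  simpa using this

end Tools

section Assemble

def ev (n i : ℕ) : Fin n → ℂ := fun x => if (x : ℕ) = i then 1 else 0

def colM {n : ℕ} (c : ℕ → Fin n → ℂ) : Matrix (Fin n) (Fin n) ℂ := fun x y => c y x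

lemma ev_eq_single {n : ℕ} (i : Fin n) : ev n i = Pi.single i 1 := by
  ext x
  simp [ev, Pi.single_apply, Fin.ext_iff]

lemma colM_ev {n : ℕ} (c : ℕ → Fin n → ℂ) (i : ℕ) (h : i < n) : colM c *ᵥ ev n i = c i := by
  have := ev_eq_single (n := n) ⟨i, h⟩
  simp only at this
  rw [this, Matrix.mulVec_single_one]
  rfl

lemma ev_top {n : ℕ} (W : Submodule ℂ (Fin n → ℂ)) (h : ∀ i < n, ev n i ∈ W) : W = ⊤ := by
  rw [eq_top_iff]
  intro x _
  rw [← Finset.univ_sum_single x]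
  apply Submodule.sum_mem
  intro i _
  have : (Pi.single i (x i) : Fin n → ℂ) = x i • Pi.single i 1 := by
    rw [← Pi.single_smul]; simp
  rw [this, ← ev_eq_single]
  exact Submodule.smul_mem _ _ (h i i.2)

lemma colM_sum {n p : ℕ} (c : Fin p → ℕ → Fin n → ℂ) : ∑ j, colM (c j) = colM (fun i => ∑ j, c j i) := by
  ext x y
  simp [colM, Matrix.sum_apply]

lemma rank_of_dist {n : ℕ} (B : Matrix (Fin n) (Fin n) ℂ) (h : HasDistinctEigenvalues B) (μ : ℂ) :
    n ≤ (B - μ • (1 : Matrix (Fin n) (Fin n) ℂ)).rank + 1 := by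
  obtain ⟨ν, hν, hc⟩ := h
  have h1 := LinearMap.finrank_maxGenEigenspace_eq (Matrix.toLin' B) μ
  have h2 : Module.finrank ℂ (LinearMap.ker (B - μ • (1 : Matrix (Fin n) (Fin n) ℂ)).mulVecLin) ≤
      Module.finrank ℂ (Module.End.maxGenEigenspace (Matrix.toLin' B) μ) := by
    apply Submodule.finrank_mono
    intro x hx
    rw [Module.End.mem_maxGenEigenspace]
    refine ⟨1, ?_⟩
    rw [LinearMap.mem_ker] at hx
    simpa [Matrix.sub_mulVec, Matrix.smul_mulVec, Matrix.toLin'_apply] using hx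
  have h3 : (Matrix.toLin' B).charpoly.rootMultiplicity μ ≤ 1 := by
    rw [Matrix.charpoly_toLin', hc]
    have : (∏ k, (X - C (ν k))).roots = Finset.univ.val.map ν := by
      rw [← Polynomial.roots_multiset_prod_X_sub_C (Finset.univ.val.map ν), Multiset.map_map]
      rfl
    rw [← Polynomial.count_roots, this]
    apply Multiset.nodup_iff_count_le_one.1
    exact Multiset.Nodup.map hν Finset.univ.nodup
  have h4 := (B - μ • (1 : Matrix (Fin n) (Fin n) ℂ)).mulVecLin.finrank_range_add_finrank_ker
  simp only [Module.finrank_fintype_fun_eq_card, Fintype.card_fin] at h4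
  rw [Matrix.rank]
  omega

lemma rk_le_rank {n : ℕ} (B : Matrix (Fin n) (Fin n) ℂ) (μ : ℂ) :
    rk B ≤ (B - μ • (1 : Matrix (Fin n) (Fin n) ℂ)).rank := ciInf_le (OrderBot.bddBelow _) μ

lemma rk_lt {n : ℕ} (hn : 0 < n) (B : Matrix (Fin n) (Fin n) ℂ) : rk B + 1 ≤ n := by
  haveI : Nonempty (Fin n) := ⟨⟨0, hn⟩⟩
  obtain ⟨μ, hμ⟩ := Module.End.exists_eigenvalue (Matrix.toLin' B)
  obtain ⟨v, hv⟩ := hμ.exists_hasEigenvector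
  have h1 := rk_le_rank B μ
  have h4 := (B - μ • (1 : Matrix (Fin n) (Fin n) ℂ)).mulVecLin.finrank_range_add_finrank_ker
  simp only [Module.finrank_fintype_fun_eq_card, Fintype.card_fin] at h4
  rw [Matrix.rank] at h1
  have h5 : LinearMap.ker (B - μ • (1 : Matrix (Fin n) (Fin n) ℂ)).mulVecLin ≠ ⊥ := by
    rw [Submodule.ne_bot_iff]
    refine ⟨v, ?_, hv.2⟩
    have := hv.apply_eq_smul
    rw [LinearMap.mem_ker]
    rw [Matrix.toLin'_apply] at this
    simp [Matrix.sub_mulVec, Matrix.smul_mulVec, this]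
  have h6 := Submodule.one_le_finrank_iff.2 h5
  omega

lemma cyc_mem {n : ℕ} (S : Matrix (Fin n) (Fin n) ℂ) (y : ℕ → Fin n → ℂ)
    (hy : ∀ l, S *ᵥ y l = y (l+1)) (hyn : ∀ l, n ≤ l → y l = 0)
    (W : Submodule ℂ (Fin n → ℂ)) (hW : ∀ v ∈ W, S *ᵥ v ∈ W) (k : ℕ) :
    ∀ (d : ℕ) (a : ℕ → ℂ), d + k + 1 = n → (∑ l ∈ Finset.range n, a l • y l ∈ W) →
      (∀ l < d, a l = 0) → a d ≠ 0 → ∀ l, d ≤ l → y l ∈ W := by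
  induction k with
  | zero =>
    intro d a hd hx ha had l hl
    rcases eq_or_lt_of_le hl with h | h
    · subst h
      rw [Finset.sum_eq_single d] at hx
      · exact (Submodule.smul_mem_iff _ had).1 hx
      · intro b hb hbd
        rw [Finset.mem_range] at hb
        rw [ha b (by omega), zero_smul]
      · intro h; rw [Finset.mem_range] at h; omega
    · rw [hyn l (by omega)]; exact W.zero_mem
  | succ k ih =>
    intro d a hd hx ha had
    have key : ∀ l, d + 1 ≤ l → y l ∈ W := by
      apply ih (d+1) (fun l => if l = 0 then 0 else a (l-1)) (by omega)
      · have h1 := hW _ hx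
        obtain ⟨n', rfl⟩ : ∃ n', n = n' + 1 := ⟨n - 1, by omega⟩
        rw [Finset.sum_range_succ']
        simp only [Nat.add_sub_cancel, Nat.succ_ne_zero, if_false, if_true, zero_smul, add_zero]
        rw [Matrix.mulVec_sum, Finset.sum_range_succ] at h1
        simp only [Matrix.mulVec_smul, hy] at h1
        rw [hyn (n'+1) (by omega), smul_zero, add_zero] at h1
        exact h1
      · intro l hl
        split_ifs with h
        · rfl
        · exact ha _ (by omega)
      · simpa using had
    intro l hl
    rcases eq_or_lt_of_le hl with h | h
    · subst h
      rw [← Finset.add_sum_erase _ _ (Finset.mem_range.2 (by omega : d < n))] at hx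
      have h2 : ∑ l ∈ (Finset.range n).erase d, a l • y l ∈ W := by
        apply Submodule.sum_mem
        intro l hl
        rw [Finset.mem_erase] at hl
        rcases lt_or_ge l d with h | h
        · rw [ha l h, zero_smul]; exact W.zero_mem
        · exact W.smul_mem _ (key l (by omega))
      exact (Submodule.smul_mem_iff _ had).1 ((Submodule.add_mem_iff_left _ h2).1 hx)
    · exact key l h

lemma span_repr {n : ℕ} (y : ℕ → Fin n → ℂ) (h : ∀ W : Submodule ℂ (Fin n → ℂ), (∀ l < n, y l ∈ W) → W = ⊤)
    (x : Fin n → ℂ) : ∃ a : ℕ → ℂ, x = ∑ l ∈ Finset.range n, a l • y l := by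
  have h1 := h (Submodule.span ℂ (Set.range (fun i : Fin n => y i))) (fun l hl => Submodule.subset_span ⟨⟨l, hl⟩, rfl⟩)
  have h2 : x ∈ Submodule.span ℂ (Set.range (fun i : Fin n => y i)) := by rw [h1]; trivial
  rw [Submodule.mem_span_range_iff_exists_fun] at h2
  obtain ⟨c, hc⟩ := h2
  refine ⟨fun l => if h : l < n then c ⟨l, h⟩ else 0, ?_⟩
  rw [← hc, Finset.sum_range]
  simp

lemma cyc_irr {n q : ℕ} (hn : 0 < n) (N : Fin q → Matrix (Fin n) (Fin n) ℂ) (S : Matrix (Fin n) (Fin n) ℂ)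
    (hS : ∀ W : Submodule ℂ (Fin n → ℂ), (∀ j, ∀ v ∈ W, N j *ᵥ v ∈ W) → ∀ v ∈ W, S *ᵥ v ∈ W)
    (y : ℕ → Fin n → ℂ)
    (hy : ∀ l, S *ᵥ y l = y (l+1)) (hyn : ∀ l, n ≤ l → y l = 0)
    (hspan : ∀ W : Submodule ℂ (Fin n → ℂ), (∀ l < n, y l ∈ W) → W = ⊤)
    (hy0 : ∀ l, 1 ≤ l → l < n → y l ⟨0, hn⟩ = 0)
    (hcorner : ∃ j, (N j *ᵥ y (n-1)) ⟨0, hn⟩ ≠ 0) : IrreducibleTuple N := by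
  intro W hW
  have hWS := hS W hW
  rw [or_iff_not_imp_left]
  intro hne
  obtain ⟨x, hx, hx0⟩ := (Submodule.ne_bot_iff _).1 hne
  obtain ⟨a, ha⟩ := span_repr y hspan x
  have hex : ∃ d, d < n ∧ a d ≠ 0 := by
    by_contra hcon
    push Not at hcon
    apply hx0
    rw [ha]
    apply Finset.sum_eq_zero
    intro l hl
    rw [hcon l (Finset.mem_range.1 hl), zero_smul]
  classical
  have hd := Nat.find_spec hex
  have hmin := fun l hl => Nat.find_min hex (m := l) hl
  have h1 := cyc_mem S y hy hyn W hWS (n - 1 - Nat.find hex) (Nat.find hex) a (by omega) (ha ▸ hx)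
    (fun l hl => by by_contra h; exact hmin l hl ⟨by omega, h⟩) hd.2 (n-1) (by omega)
  obtain ⟨j, hj⟩ := hcorner
  have h2 := hW j _ h1
  obtain ⟨b, hb⟩ := span_repr y hspan (N j *ᵥ y (n-1))
  rw [show (N j).mulVec (y (n-1)) = _ from hb] at h2
  have hb0 : b 0 ≠ 0 := by
    intro h
    apply hj
    rw [hb, Finset.sum_apply]
    apply Finset.sum_eq_zero
    intro l hl
    rw [Finset.mem_range] at hl
    rcases Nat.eq_zero_or_pos l with h' | h'
    · subst h'; simp [h]
    · simp [hy0 l h' hl]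
  have h3 := cyc_mem S y hy hyn W hWS (n-1) 0 b (by omega) h2 (by simp) hb0
  exact hspan W (fun l _ => h3 l (by omega))

/-- The conclusion of the main theorem. -/
def Concl {n p : ℕ} (B : Fin (p+1) → Matrix (Fin n) (Fin n) ℂ) : Prop :=
  ∃ A : Fin (p + 1) → Matrix (Fin n) (Fin n) ℂ,
      (∀ j, SameClass (A j) (B j)) ∧ ∑ j, A j = 0 ∧ IrreducibleTuple A

/-- Combinatorial goal -/
def Good (n p : ℕ) (hn : 0 < n) (r : Fin p → ℕ) : Prop :=
  ∃ (N : Fin p → Matrix (Fin n) (Fin n) ℂ) (y : ℕ → Fin n → ℂ),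
    (∀ j, Ty (n - r j) (N j)) ∧
    (∀ l, l + 1 < n → (∑ j, N j) *ᵥ y l = y (l+1)) ∧ ((∑ j, N j) *ᵥ y (n-1) = 0) ∧
    (∀ W : Submodule ℂ (Fin n → ℂ), (∀ l < n, y l ∈ W) → W = ⊤) ∧
    (∀ l, 1 ≤ l → l < n → y l ⟨0, hn⟩ = 0) ∧
    (∃ j, (N j *ᵥ y (n-1)) ⟨0, hn⟩ ≠ 0)

lemma assemble {n p : ℕ} (hn : 0 < n) (B : Fin (p+1) → Matrix (Fin n) (Fin n) ℂ)
    (hdist : HasDistinctEigenvalues (B 0)) (htrace : ∑ j, (B j).trace = 0)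
    (r : Fin p → ℕ) (hr : ∀ j, r j ≤ rk (B j.succ)) (hg : Good n p hn r) : Concl B := by
  obtain ⟨N, y, hT, hy1, hy2, hspan, hy0, hcor⟩ := hg
  set S := ∑ j, N j with hS
  have hrn : ∀ j, r j + 1 ≤ n := fun j => (Nat.add_le_add_right (hr j) 1).trans (rk_lt hn _)
  refine deform hn (N := Fin.cons (-S) N) ?_ ?_ ?_ htrace
  · apply cyc_irr hn _ S ?_ (fun l => if l < n then y l else 0)
    · intro l
      rcases lt_trichotomy (l+1) n with h | h | h
      · rw [if_pos (by omega), if_pos h]; exact hy1 l h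
      · rw [if_pos (by omega), if_neg (by omega)]
        have : l = n - 1 := by omega
        rw [this]; exact hy2
      · rw [if_neg (by omega), if_neg (by omega)]; simp
    · intro l hl
      rw [if_neg (by omega)]
    · intro W hW
      apply hspan
      intro l hl
      have := hW l hl
      simpa [hl] using this
    · intro l h1 h2
      simp only [if_pos h2]
      exact hy0 l h1 h2
    · obtain ⟨j, hj⟩ := hcor
      refine ⟨j.succ, ?_⟩
      simp only [Fin.cons_succ]
      rw [if_pos (by omega)]
      exact hj
    · intro W hW v hv
      have := hW 0 v hv
      simp only [Fin.cons_zero, Matrix.neg_mulVec] at this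
      exact (Submodule.neg_mem_iff _).1 this
  · rw [Fin.sum_univ_succ]
    simp [hS]
  · intro j
    refine Fin.cases ?_ ?_ j
    · simp only [Fin.cons_zero]
      have : Ty 1 (-S) := by
        apply cone_of_chains (ι := Unit) (by simp) (-S) (fun _ => n) (fun _ l => ((-1:ℂ)^l) • y l)
        · simp
        · intro _ _; simp
        · intro _ l hl
          rw [Matrix.mulVec_smul, Matrix.neg_mulVec, hy1 l hl, pow_succ]
          simp
        · intro _ l hl
          have : l = n - 1 := by omega
          subst this
          rw [Matrix.mulVec_smul, Matrix.neg_mulVec, hy2]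
          simp
        · intro W hW
          apply hspan
          intro l hl
          exact (Submodule.smul_mem_iff _ (by simp)).1 (hW () l hl)
      exact this _ (rank_of_dist _ hdist)
    · intro j
      simp only [Fin.cons_succ]
      apply hT j
      intro μ
      have h1 := rk_le_rank (B j.succ) μ
      have := hr j
      have := hrn j
      omega

end Assemble

section Split

lemma exists_color {α : Type*} {p : ℕ} (L : Finset α) (r : Fin p → ℕ) (h : L.card ≤ ∑ j, r j) :
    ∃ col : {x // x ∈ L} → Fin p, ∀ j, (Finset.univ.filter (fun x => col x = j)).card ≤ r j := by
  obtain ⟨g⟩ : Nonempty ({x // x ∈ L} ↪ (Σ j : Fin p, Fin (r j))) := by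
    apply Function.Embedding.nonempty_of_card_le
    simpa using h
  refine ⟨fun x => (g x).1, fun j => ?_⟩
  have h1 : (Finset.univ.filter (fun x => (g x).1 = j)).card ≤
      (Finset.univ.map (Function.Embedding.sigmaMk (β := fun j => Fin (r j)) j)).card := by
    apply Finset.card_le_card_of_injOn g
    · intro x hx
      simp only [Finset.coe_filter, Finset.mem_univ, true_and] at hx
      have hx' : (g x).1 = j := hx
      simp only [Finset.coe_map, Set.mem_image]
      refine ⟨hx' ▸ (g x).2, by simp, ?_⟩
      subst hx'
      rfl
    · exact g.injective.injOn
  simpa using h1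

lemma bip_split {n p : ℕ} (N : Matrix (Fin n) (Fin n) ℂ) (L : Finset (Fin n)) (r : Fin p → ℕ)
    (hL : L.card ≤ ∑ j, r j) (hN : ∀ x y, N x y ≠ 0 → y ∈ L ∧ x ∉ L) :
    ∃ M : Fin p → Matrix (Fin n) (Fin n) ℂ, ∑ j, M j = N ∧
      ∀ j, ∃ L' : Finset (Fin n), L' ⊆ L ∧ L'.card ≤ r j ∧ ∀ x y, M j x y ≠ 0 → y ∈ L' ∧ x ∉ L' := by
  classical
  obtain ⟨col, hcol⟩ := exists_color L r hL
  refine ⟨fun j => Matrix.of fun x y => if h : y ∈ L then (if col ⟨y, h⟩ = j then N x y else 0) else 0, ?_, ?_⟩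
  · ext x y
    rw [Matrix.sum_apply]
    by_cases h : y ∈ L
    · simp [h]
    · have h0 : N x y = 0 := by
        by_contra h'
        exact h (hN x y h').1
      simp [h, h0]
  · intro j
    have hsub : (Finset.univ.filter (fun x => col x = j)).map (Function.Embedding.subtype _) ⊆ L := by
      intro x hx
      simp only [Finset.mem_map, Function.Embedding.coe_subtype] at hx
      obtain ⟨a, _, rfl⟩ := hx
      exact a.2
    refine ⟨_, hsub, ?_, ?_⟩
    · rw [Finset.card_map]; exact hcol j
    · intro x y hxy
      simp only [Matrix.of_apply] at hxy
      split_ifs at hxy with h1 h2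
      · refine ⟨?_, fun h => (hN x y hxy).2 (hsub h)⟩
        simp only [Finset.mem_map, Function.Embedding.coe_subtype]
        exact ⟨⟨y, h1⟩, by simp [h2], rfl⟩
      · simp at hxy
      · simp at hxy

def DataI (n m : ℕ) (hn : 0 < n) : Prop :=
  ∃ (c2 c3 : ℕ → Fin n → ℂ) (E : ℕ → ℕ) (y : ℕ → Fin n → ℂ), Ty m (colM c2) ∧
    (∀ i < n, ∀ x : Fin n, c3 i x ≠ 0 → (∃ k ≤ m, i = E k) ∧ (∀ k ≤ m, (x : ℕ) ≠ E k)) ∧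
    (∀ l, l + 1 < n → (colM (c2 + c3)) *ᵥ y l = y (l+1)) ∧ ((colM (c2 + c3)) *ᵥ y (n-1) = 0) ∧
    (∀ W : Submodule ℂ (Fin n → ℂ), (∀ l < n, y l ∈ W) → W = ⊤) ∧
    (∀ l, 1 ≤ l → l < n → y l ⟨0, hn⟩ = 0) ∧
    (colM c2 *ᵥ y (n-1)) ⟨0, hn⟩ ≠ 0

lemma caseI {n m p : ℕ} (hn : 0 < n) (hnm : 2 * m + 2 ≤ n) (r : Fin p → ℕ) (hr : ∑ j, r j = n + 1) (j0 : Fin p)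
    (hr0 : r j0 = n - m) (hD : DataI n m hn) : Good n p hn r := by
  classical
  obtain ⟨c2, c3, E, y, hT, h3, hy1, hy2, hspan, hy0, hcor⟩ := hD
  let L : Finset (Fin n) := Finset.univ.filter (fun x => ∃ k ≤ m, (x : ℕ) = E k)
  have hLc : L.card ≤ m + 1 := by
    have : L.card ≤ ((Finset.range (m+1)).image E).card := by
      apply Finset.card_le_card_of_injOn (fun x : Fin n => (x : ℕ))
      · intro x hx
        have hx' : x ∈ L := hx
        simp only [L, Finset.mem_filter] at hx'
        obtain ⟨_, k, hk, hxk⟩ := hx'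
        simp only [Finset.coe_image, Set.mem_image]
        exact ⟨k, by simpa using Nat.lt_succ_of_le hk, hxk.symm⟩
      · exact Fin.val_injective.injOn
    refine this.trans (Finset.card_image_le.trans ?_)
    simp
  have hsum : ∑ j, Function.update r j0 0 j = m + 1 := by
    rw [Finset.sum_update_of_mem (Finset.mem_univ _)]
    have := Finset.add_sum_erase Finset.univ r (Finset.mem_univ j0)
    rw [Finset.sdiff_singleton_eq_erase]
    omega
  obtain ⟨M, hM, hML⟩ := bip_split (colM c3) L (Function.update r j0 0) (by omega) (by
    intro x i h
    have := h3 i i.2 x h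
    simp only [L, Finset.mem_filter, Finset.mem_univ, true_and, not_exists, not_and]
    exact this)
  have hMT : ∀ j, j ≠ j0 → Ty (n - r j) (M j) := by
    intro j hj
    obtain ⟨L', hL', hc, hb⟩ := hML j
    rw [Function.update_of_ne hj] at hc
    have := Finset.card_le_card hL'
    exact Ty_bip _ L' hc (by omega) hb
  have hM0 : M j0 = 0 := by
    obtain ⟨L', hL', hc, hb⟩ := hML j0
    simp only [Function.update_self, Nat.le_zero, Finset.card_eq_zero] at hc
    subst hc
    ext x z
    by_contra h
    simpa using (hb x z h).1
  let N : Fin p → Matrix (Fin n) (Fin n) ℂ := fun j => (if j = j0 then colM c2 else 0) + M j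
  have hN0 : N j0 = colM c2 := by simp [N, hM0]
  have hNS : ∑ j, N j = colM (c2 + c3) := by
    simp only [N]
    rw [Finset.sum_add_distrib, hM]
    simp
    rfl
  refine ⟨N, y, ?_, ?_, ?_, hspan, hy0, j0, ?_⟩
  · intro j
    by_cases hj : j = j0
    · subst hj
      rw [hN0, hr0, show n - (n - m) = m by omega]
      exact hT
    · simp only [N, if_neg hj, zero_add]
      exact hMT j hj
  · rw [hNS]; exact hy1
  · rw [hNS]; exact hy2
  · rw [hN0]; exact hcor

lemma tri_span {n : ℕ} (y : ℕ → Fin n → ℂ)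
    (h : ∀ l < n, ∀ W : Submodule ℂ (Fin n → ℂ), (∀ i < l, ev n i ∈ W) → y l ∈ W → ev n l ∈ W)
    (W : Submodule ℂ (Fin n → ℂ)) (hW : ∀ l < n, y l ∈ W) : W = ⊤ := by
  apply ev_top
  intro i
  induction i using Nat.strong_induction_on with
  | _ i ih =>
    intro hi
    exact h i hi W (fun k hk => ih k hk (by omega)) (hW i hi)

end Split

section F1a

lemma step_find (q : ℕ → ℕ) (h0 : q 0 = 0) (t : ℕ) : ∀ K, t < q K → ∃ k < K, q k ≤ t ∧ t < q (k+1) := by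
  intro K
  induction K with
  | zero => intro h; omega
  | succ K ih =>
    intro h
    by_cases h1 : t < q K
    · obtain ⟨k, hk, h2⟩ := ih h1
      exact ⟨k, by omega, h2⟩
    · exact ⟨K, by omega, by omega, h⟩

lemma F1a_gen {n m : ℕ} (hn : 0 < n) (hm : 0 < m) (q : ℕ → ℕ) (h0 : q 0 = 0) (hq : q m = n)
    (h3 : ∀ k, q k + 3 ≤ q (k+1)) (h4 : q (m-1) + 4 ≤ n)
    (hb : ∀ i j, (q (i+1) - q i) ≤ (q (j+1) - q j) + 1) : DataI n m hn := by
  classical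
  have hmono : Monotone q := monotone_nat_of_le_succ (fun k => by have := h3 k; omega)
  have hlast : ∀ k < m, q k + 4 ≤ n := fun k hk => by
    have := hmono (show k ≤ m - 1 by omega); omega
  have hns : 4 ≤ n := by have := hlast 0 hm; omega
  let PE : ℕ → Prop := fun i => ∃ k < m, i = 1 + q k
  have hPE1 : ∀ k i, q k + 1 < i → i < q (k+1) + 1 → ¬ PE i := by
    rintro k i h1 h2 ⟨k', hk', rfl⟩
    rcases Nat.lt_or_ge k' (k+1) with h | h
    · have := hmono (show k' ≤ k by omega); omega
    · have := hmono h; omega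
  have hPE0 : ¬ PE 0 := by rintro ⟨k, _, h⟩; omega
  have hPEn : ¬ PE (n-1) := by rintro ⟨k, hk, h⟩; have := hlast k hk; omega
  let c2 : ℕ → Fin n → ℂ := fun i => if PE i then 0 else ev n ((i+1) % n)
  let c3 : ℕ → Fin n → ℂ := fun i => if PE i then ev n (i+1) else if i = n - 1 then - ev n 0 else 0
  have hS : ∀ i, i + 1 < n → (c2 + c3) i = ev n (i+1) := by
    intro i hi
    simp only [Pi.add_apply, c2, c3]
    split_ifs with h1 h2
    · simp
    · omega
    · rw [Nat.mod_eq_of_lt hi]; simp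
  have hSn : (c2 + c3) (n-1) = 0 := by
    simp only [Pi.add_apply, c2, c3, if_neg hPEn, if_true]
    rw [Nat.sub_add_cancel hn, Nat.mod_self]; simp
  refine ⟨c2, c3, fun k => if k < m then 1 + q k else n - 1, fun l => ev n l, ?_, ?_, ?_, ?_, ?_, ?_, ?_⟩
  · apply cone_of_chains (ι := Fin m) (by simp) (colM c2) (fun k => q (k+1) - q k)
      (fun k l => ev n ((2 + q k + l) % n))
    · rw [Fin.sum_univ_eq_sum_range (fun k => q (k+1) - q k) m, Finset.sum_range_tsub hmono]; omega
    · intro i j; exact hb i j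
    · intro k l hl
      beta_reduce at hl ⊢
      rw [colM_ev _ _ (Nat.mod_lt _ hn)]
      have hk1 := hmono (show (k:ℕ)+1 ≤ m by omega)
      have hnot : ¬ PE ((2 + q k + l) % n) := by
        rcases Nat.lt_or_ge (2 + q k + l) n with h | h
        · rw [Nat.mod_eq_of_lt h]
          exact hPE1 k _ (by omega) (by omega)
        · have : 2 + q k + l = n := by omega
          rw [this, Nat.mod_self]; exact hPE0
      simp only [c2, if_neg hnot]
      congr 1
      rw [Nat.mod_add_mod]; rfl
    · intro k l hl
      beta_reduce at hl ⊢
      rw [colM_ev _ _ (Nat.mod_lt _ hn)]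
      have h3k := h3 k
      have : PE ((2 + q k + l) % n) := by
        have h1 : 2 + q k + l = 1 + q (k+1) := by omega
        rw [h1]
        rcases Nat.lt_or_ge ((k:ℕ)+1) m with h | h
        · have := hlast _ h
          rw [Nat.mod_eq_of_lt (by omega)]
          exact ⟨_, h, rfl⟩
        · have : (k:ℕ)+1 = m := by omega
          rw [this, hq, Nat.add_mod_right, Nat.mod_eq_of_lt (by omega)]
          exact ⟨0, hm, by omega⟩
      simp only [c2, if_pos this]
    · intro W hW
      apply ev_top
      intro i hi
      have key : ∀ t, t < n → (2 + t) % n = i → ev n i ∈ W := by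
        intro t ht hti
        obtain ⟨k, hk, h1, h2⟩ := step_find q h0 t m (by omega)
        have := hW ⟨k, hk⟩ (t - q k) (by simp only; omega)
        simp only at this
        rw [show 2 + q k + (t - q k) = 2 + t by omega, hti] at this
        exact this
      rcases Nat.lt_or_ge i 2 with h | h
      · apply key (n - 2 + i) (by omega)
        rw [show 2 + (n - 2 + i) = i + n by omega, Nat.add_mod_right, Nat.mod_eq_of_lt hi]
      · apply key (i - 2) (by omega)
        rw [show 2 + (i - 2) = i by omega, Nat.mod_eq_of_lt hi]
  · intro i hi x hx
    simp only [c3] at hx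
    split_ifs at hx with h1 h2
    · have hxi : (x : ℕ) = i + 1 := by by_contra h; simp [ev, h] at hx
      obtain ⟨k, hk, hik⟩ := h1
      refine ⟨⟨k, by omega, by simp [hk, hik]⟩, ?_⟩
      intro k' hk'
      simp only
      have h3k := h3 k
      have hl := hlast k hk
      split_ifs with h
      · intro h5
        exact hPE1 k x (by omega) (by omega) ⟨k', h, h5⟩
      · omega
    · have hx0 : (x : ℕ) = 0 := by by_contra h; simp [ev, h] at hx
      refine ⟨⟨m, le_refl _, by simp [h2]⟩, ?_⟩
      intro k' hk'
      simp only
      split_ifs <;> omega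
    · simp at hx
  · intro l hl
    rw [colM_ev _ _ (by omega), hS l hl]
  · rw [colM_ev _ _ (by omega), hSn]
  · intro W hW
    exact ev_top W hW
  · intro l h1 h2
    simp [ev]; omega
  · rw [colM_ev _ _ (by omega)]
    simp only [c2, if_neg hPEn]
    rw [Nat.sub_add_cancel hn, Nat.mod_self]; simp [ev]

lemma F1a {n m : ℕ} (hn : 0 < n) (hm : 0 < m) (h : 3 * m + 1 ≤ n) : DataI n m hn := by
  have key : ∀ k, (k+1) * n / m = k * n / m + n / m + if m ≤ (k*n) % m + n % m then 1 else 0 := by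
    intro k
    rw [add_mul, one_mul, Nat.add_div hm]
  have h3 : 3 ≤ n / m := by
    rw [Nat.le_div_iff_mul_le hm]; omega
  apply F1a_gen hn hm (fun k => k * n / m)
  · simp
  · exact Nat.mul_div_cancel_left n hm
  · intro k
    have := key k
    omega
  · have h1 : (m - 1) * n / m * m ≤ (m-1) * n := Nat.div_mul_le_self _ _
    obtain ⟨m', rfl⟩ : ∃ m', m = m' + 1 := ⟨m - 1, by omega⟩
    simp only [Nat.add_sub_cancel] at h1 ⊢
    by_contra hc
    push Not at hc
    generalize m' * n / (m'+1) = Q at *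
    nlinarith
  · intro i j
    simp only [key i, key j]
    split_ifs <;> omega

end F1a

section F1c

lemma ev_ne {n i : ℕ} {x : Fin n} (h : ev n i x ≠ 0) : (x : ℕ) = i := by
  by_contra h'; simp [ev, h'] at h

lemma ev_ne_neg {n i : ℕ} {x : Fin n} (h : (- ev n i) x ≠ 0) : (x : ℕ) = i := by
  by_contra h'; simp [ev, h'] at h

lemma ev0 {n i : ℕ} (hn : 0 < n) (h : i ≠ 0) : ev n i ⟨0, hn⟩ = 0 := by
  simp only [ev]
  rw [if_neg (by omega)]

lemma ev00 {n : ℕ} (hn : 0 < n) : ev n 0 ⟨0, hn⟩ = 1 := by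
  simp [ev]

lemma F1c_odd {n m v : ℕ} (hn : 0 < n) (hv : 0 < v) (hm : m = 2 * v) (hnv : n = 4 * v + 2) : DataI n m hn := by
  let c2 : ℕ → Fin n → ℂ := fun i => if i = 2*v+1 then - ev n 1 else if i = n - 1 then ev n (2*v+1) + ev n 0 else
    if i % 2 = 0 then ev n (i+1) else 0
  let c3 : ℕ → Fin n → ℂ := fun i => if i = n - 1 then - ev n 0 else if i % 2 = 0 then 0 else ev n (i+1)
  have hS : ∀ i, i + 1 < n → i ≠ 2*v+1 → colM (c2 + c3) *ᵥ ev n i = ev n (i+1) := by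
    intro i hi h1
    rw [colM_ev _ _ (by omega)]
    simp only [Pi.add_apply, c2, c3, if_neg h1, if_neg (show i ≠ n - 1 by omega)]
    split_ifs <;> simp
  have hSu : colM (c2 + c3) *ᵥ ev n (2*v+1) = ev n (2*v+2) - ev n 1 := by
    rw [colM_ev _ _ (by omega)]
    simp only [Pi.add_apply, c2, c3, if_true, if_neg (show 2*v+1 ≠ n - 1 by omega), if_neg (show ¬ (2*v+1) % 2 = 0 by omega)]
    abel
  have hSn : colM (c2 + c3) *ᵥ ev n (n-1) = ev n (2*v+1) := by
    rw [colM_ev _ _ (by omega)]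
    simp only [Pi.add_apply, c2, c3, if_true, if_neg (show n - 1 ≠ 2*v+1 by omega)]
    abel
  have h2e : ∀ i < n, i % 2 = 0 → colM c2 *ᵥ ev n i = ev n (i+1) := by
    intro i hi h
    rw [colM_ev _ _ hi]
    simp only [c2, if_neg (show i ≠ 2*v+1 by omega), if_neg (show i ≠ n-1 by omega), if_pos h]
  have h2u : colM c2 *ᵥ ev n (2*v+1) = - ev n 1 := by
    rw [colM_ev _ _ (by omega)]
    simp only [c2, if_true]
  have h2n : colM c2 *ᵥ ev n (n-1) = ev n (2*v+1) + ev n 0 := by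
    rw [colM_ev _ _ (by omega)]
    simp only [c2, if_true, if_neg (show n - 1 ≠ 2*v+1 by omega)]
  have h2o : ∀ i < n, i % 2 = 1 → i ≠ 2*v+1 → i ≠ n-1 → colM c2 *ᵥ ev n i = 0 := by
    intro i hi h h1 h2
    rw [colM_ev _ _ hi]
    simp only [c2, if_neg h1, if_neg h2, if_neg (show ¬ i % 2 = 0 by omega)]
  let y : ℕ → Fin n → ℂ := fun l => if l ≤ 2*v+1 then ev n l else ev n l - ev n (l - (2*v+1))
  have hy1 : ∀ l, l ≤ 2*v+1 → y l = ev n l := fun l h => by simp only [y, if_pos h]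
  have hy2 : ∀ l, 2*v+1 < l → y l = ev n l - ev n (l - (2*v+1)) := fun l h => by
    simp only [y, if_neg (show ¬ l ≤ 2*v+1 by omega)]
  have hyn : y (n-1) = ev n (n-1) - ev n (2*v) := by
    rw [hy2 _ (by omega), show n - 1 - (2*v+1) = 2*v by omega]
  refine ⟨c2, c3, fun k => 2*k+1, y, ?_, ?_, ?_, ?_, ?_, ?_, ?_⟩
  · let s : ℕ → ℕ := fun k => 2 + (if k = v-1 then 1 else 0) + (if k = m-1 then 1 else 0)
    apply cone_of_chains (ι := Fin m) (by simp) (colM c2) (fun k => s k)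
      (fun k l => if l = 0 then ev n (2*k+2) else if l = 1 then ev n (2*k+3) else
        if (k:ℕ) = v-1 then - ev n 1 else ev n (2*v+1) + ev n 0)
    · rw [Fin.sum_univ_eq_sum_range s m]
      simp only [s]
      rw [Finset.sum_add_distrib, Finset.sum_add_distrib, Finset.sum_ite_eq', Finset.sum_ite_eq',
        if_pos (Finset.mem_range.2 (by omega)), if_pos (Finset.mem_range.2 (by omega))]
      simp; omega
    · intro i j
      simp only [s]
      split_ifs <;> omega
    · intro k l hl
      have hk := k.2
      have hl3 : l = 0 ∨ (l = 1 ∧ ((k:ℕ) = v-1 ∨ (k:ℕ) = m-1)) := by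
        simp only [s] at hl
        split_ifs at hl <;> omega
      rcases hl3 with rfl | ⟨rfl, h | h⟩
      · simp only [if_true, zero_add, one_ne_zero, if_false]
        rw [h2e _ (by omega) (by omega)]
      · simp only [if_true, Nat.reduceAdd, one_ne_zero, if_false, h, OfNat.ofNat_ne_zero, OfNat.ofNat_ne_one]
        rw [show 2 * (v-1) + 3 = 2*v+1 by omega, h2u]
      · have hne : ¬ m - 1 = v - 1 := by omega
        simp only [if_true, Nat.reduceAdd, one_ne_zero, if_false, h, OfNat.ofNat_ne_zero, OfNat.ofNat_ne_one, hne]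
        rw [show 2 * (m-1) + 3 = n - 1 by omega, h2n]
    · intro k l hl
      have hk := k.2
      have hl3 : (l = 1 ∧ (k:ℕ) ≠ v-1 ∧ (k:ℕ) ≠ m-1) ∨ (l = 2 ∧ (k:ℕ) = v-1) ∨ (l = 2 ∧ (k:ℕ) = m-1) := by
        simp only [s] at hl
        split_ifs at hl <;> omega
      rcases hl3 with ⟨rfl, h1, h2⟩ | ⟨rfl, h⟩ | ⟨rfl, h⟩
      · simp only [if_true, one_ne_zero, if_false]
        rw [h2o _ (by omega) (by omega) (by omega) (by omega)]
      · simp only [if_true, if_false, h, OfNat.ofNat_ne_zero, OfNat.ofNat_ne_one]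
        rw [Matrix.mulVec_neg, h2o _ (by omega) (by omega) (by omega) (by omega), neg_zero]
      · have hne : ¬ m - 1 = v - 1 := by omega
        simp only [if_false, h, OfNat.ofNat_ne_zero, OfNat.ofNat_ne_one, hne]
        rw [Matrix.mulVec_add, h2u, h2e 0 (by omega) (by omega)]
        simp
    · intro W hW
      have hbig : ∀ i, 2 ≤ i → i < n → ev n i ∈ W := by
        intro i h1 h2
        have := hW ⟨(i-2)/2, by omega⟩ (i % 2) (by simp only [s]; omega)
        rcases Nat.mod_two_eq_zero_or_one i with h | h
        · simp only [h, if_true] at this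
          rwa [show 2 * ((i-2)/2) + 2 = i by omega] at this
        · simp only [h, if_true, one_ne_zero, if_false] at this
          rwa [show 2 * ((i-2)/2) + 3 = i by omega] at this
      have h1 : ev n 1 ∈ W := by
        have := hW ⟨v-1, by omega⟩ 2 (by simp only [s, if_true]; omega)
        simp only [if_true, OfNat.ofNat_ne_zero, OfNat.ofNat_ne_one, if_false] at this
        exact (Submodule.neg_mem_iff _).1 this
      have h0 : ev n 0 ∈ W := by
        have := hW ⟨m-1, by omega⟩ 2 (by simp only [s, if_true]; omega)
        simp only [if_neg (show ¬ m - 1 = v - 1 by omega), OfNat.ofNat_ne_zero, OfNat.ofNat_ne_one, if_false] at this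
        exact (Submodule.add_mem_iff_right _ (hbig _ (by omega) (by omega))).1 this
      apply ev_top
      intro i hi
      rcases (by omega : i = 0 ∨ i = 1 ∨ 2 ≤ i) with rfl | rfl | h
      · exact h0
      · exact h1
      · exact hbig i h hi
  · intro i hi x hx
    simp only [c3] at hx
    split_ifs at hx with h1 h2
    · have hx0 := ev_ne_neg hx
      exact ⟨⟨m, le_refl _, by beta_reduce; omega⟩, fun k hk => by beta_reduce; omega⟩
    · simp at hx
    · have hx0 := ev_ne hx
      exact ⟨⟨i/2, by omega, by beta_reduce; omega⟩, fun k hk => by beta_reduce; omega⟩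
  · intro l hl
    rcases lt_trichotomy l (2*v+1) with h | h | h
    · rw [hy1 _ (by omega), hy1 _ (by omega), hS l hl (by omega)]
    · subst h
      rw [hy1 _ (by omega), hy2 _ (by omega), hSu]
      congr 2; omega
    · rw [hy2 _ h, hy2 _ (by omega), Matrix.mulVec_sub, hS l hl (by omega), hS _ (by omega) (by omega)]
      congr 2; omega
  · rw [hyn, Matrix.mulVec_sub, hSn, hS _ (by omega) (by omega), sub_self]
  · apply tri_span
    intro l hl W hW hyl
    rcases Nat.lt_or_ge (2*v+1) l with h | h
    · rw [hy2 _ h] at hyl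
      exact (Submodule.sub_mem_iff_left _ (hW _ (by omega))).1 hyl
    · rwa [hy1 _ h] at hyl
  · intro l h1 h2
    rcases Nat.lt_or_ge (2*v+1) l with h | h
    · rw [hy2 _ h, Pi.sub_apply, ev0 _ (by omega), ev0 _ (by omega), sub_zero]
    · rw [hy1 _ h, ev0 _ (by omega)]
  · rw [hyn, Matrix.mulVec_sub, h2n, h2e _ (by omega) (by omega)]
    simp [ev]

end F1c

section F1ce

lemma F1c_even {n m v : ℕ} (hn : 0 < n) (hv : 0 < v) (hm : m = 2 * v + 1) (hnv : n = 4 * v + 4) : DataI n m hn := by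
  let c2 : ℕ → Fin n → ℂ := fun i => if i = 2*v+1 then - ev n 1 else if i = 2*v+3 then - ev n 1 else
    if i = n - 1 then ev n (2*v+1) + ev n (2*v+3) + (2:ℂ) • ev n 0 else
    if i % 2 = 0 then ev n (i+1) else 0
  let c3 : ℕ → Fin n → ℂ := fun i => if i = n - 1 then - ev n 2 - (2:ℂ) • ev n 0 else if i % 2 = 0 then 0 else ev n (i+1)
  have hS : ∀ i, i + 1 < n → i ≠ 2*v+1 → i ≠ 2*v+3 → colM (c2 + c3) *ᵥ ev n i = ev n (i+1) := by
    intro i hi h1 h2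
    rw [colM_ev _ _ (by omega)]
    simp only [Pi.add_apply, c2, c3, if_neg h1, if_neg h2, if_neg (show i ≠ n - 1 by omega)]
    split_ifs <;> simp
  have hSu : ∀ i, i = 2*v+1 ∨ i = 2*v+3 → colM (c2 + c3) *ᵥ ev n i = ev n (i+1) - ev n 1 := by
    intro i hi
    rw [colM_ev _ _ (by omega)]
    simp only [Pi.add_apply, c2, c3, if_neg (show i ≠ n - 1 by omega), if_neg (show ¬ i % 2 = 0 by omega)]
    rcases hi with h | h
    · rw [if_pos h]; abel
    · rw [if_neg (by omega), if_pos h]; abel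
  have hSn : colM (c2 + c3) *ᵥ ev n (n-1) = ev n (2*v+1) + ev n (2*v+3) - ev n 2 := by
    rw [colM_ev _ _ (by omega)]
    simp only [Pi.add_apply, c2, c3, if_true, if_neg (show n - 1 ≠ 2*v+1 by omega), if_neg (show n - 1 ≠ 2*v+3 by omega)]
    abel
  have h2e : ∀ i < n, i % 2 = 0 → colM c2 *ᵥ ev n i = ev n (i+1) := by
    intro i hi h
    rw [colM_ev _ _ hi]
    simp only [c2, if_neg (show i ≠ 2*v+1 by omega), if_neg (show i ≠ 2*v+3 by omega), if_neg (show i ≠ n-1 by omega), if_pos h]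
  have h2u : ∀ i, i = 2*v+1 ∨ i = 2*v+3 → colM c2 *ᵥ ev n i = - ev n 1 := by
    intro i hi
    rw [colM_ev _ _ (by omega)]
    simp only [c2]
    rcases hi with h | h
    · rw [if_pos h]
    · rw [if_neg (by omega), if_pos h]
  have h2n : colM c2 *ᵥ ev n (n-1) = ev n (2*v+1) + ev n (2*v+3) + (2:ℂ) • ev n 0 := by
    rw [colM_ev _ _ (by omega)]
    simp only [c2, if_true, if_neg (show n - 1 ≠ 2*v+1 by omega), if_neg (show n - 1 ≠ 2*v+3 by omega)]
  have h2o : ∀ i < n, i % 2 = 1 → i ≠ 2*v+1 → i ≠ 2*v+3 → i ≠ n-1 → colM c2 *ᵥ ev n i = 0 := by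
    intro i hi h h1 h2 h3
    rw [colM_ev _ _ hi]
    simp only [c2, if_neg h1, if_neg h2, if_neg h3, if_neg (show ¬ i % 2 = 0 by omega)]
  let y : ℕ → Fin n → ℂ := fun l => if l ≤ 2*v+1 then ev n l else
    if l ≤ 2*v+3 then ev n l - ev n (l - (2*v+1)) else
    if l = n - 1 then ev n (n-1) - ev n (2*v+2) - ev n (2*v) + ev n 1 else
    ev n l - ev n (l - (2*v+1)) - ev n (l - (2*v+3))
  have hy1 : ∀ l, l ≤ 2*v+1 → y l = ev n l := fun l h => by simp only [y, if_pos h]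
  have hy2 : ∀ l, 2*v+1 < l → l ≤ 2*v+3 → y l = ev n l - ev n (l - (2*v+1)) := fun l h h' => by
    simp only [y, if_neg (show ¬ l ≤ 2*v+1 by omega), if_pos h']
  have hy3 : ∀ l, 2*v+3 < l → l < n - 1 → y l = ev n l - ev n (l - (2*v+1)) - ev n (l - (2*v+3)) := fun l h h' => by
    simp only [y, if_neg (show ¬ l ≤ 2*v+1 by omega), if_neg (show ¬ l ≤ 2*v+3 by omega), if_neg (show ¬ l = n - 1 by omega)]
  have hyn : y (n-1) = ev n (n-1) - ev n (2*v+2) - ev n (2*v) + ev n 1 := by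
    simp only [y, if_neg (show ¬ n - 1 ≤ 2*v+1 by omega), if_neg (show ¬ n - 1 ≤ 2*v+3 by omega), if_true]
  refine ⟨c2, c3, fun k => 2*k+1, y, ?_, ?_, ?_, ?_, ?_, ?_, ?_⟩
  · let s : ℕ → ℕ := fun k => 2 + (if k = v-1 then 1 else 0) + (if k = m-1 then 1 else 0)
    apply cone_of_chains (ι := Fin m) (by simp) (colM c2) (fun k => s k)
      (fun k l => if l = 0 then (if (k:ℕ) = v then ev n (2*v+2) - ev n (2*v) else ev n (2*k+2)) else
        if l = 1 then (if (k:ℕ) = v then ev n (2*v+3) - ev n (2*v+1) else ev n (2*k+3)) else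
        if (k:ℕ) = v-1 then - ev n 1 else ev n (2*v+1) + ev n (2*v+3) + (2:ℂ) • ev n 0)
    · rw [Fin.sum_univ_eq_sum_range s m]
      simp only [s]
      rw [Finset.sum_add_distrib, Finset.sum_add_distrib, Finset.sum_ite_eq', Finset.sum_ite_eq',
        if_pos (Finset.mem_range.2 (by omega)), if_pos (Finset.mem_range.2 (by omega))]
      simp; omega
    · intro i j
      simp only [s]
      split_ifs <;> omega
    · intro k l hl
      have hk := k.2
      have hl3 : l = 0 ∨ (l = 1 ∧ ((k:ℕ) = v-1 ∨ (k:ℕ) = m-1)) := by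
        simp only [s] at hl
        split_ifs at hl <;> omega
      rcases hl3 with rfl | ⟨rfl, h | h⟩
      · simp only [if_true, zero_add, one_ne_zero, if_false]
        split_ifs with h
        · rw [Matrix.mulVec_sub, h2e _ (by omega) (by omega), h2e _ (by omega) (by omega)]
        · rw [h2e _ (by omega) (by omega)]
      · have hne : ¬ v - 1 = v := by omega
        simp only [if_true, Nat.reduceAdd, one_ne_zero, if_false, h, OfNat.ofNat_ne_zero, OfNat.ofNat_ne_one, hne]
        rw [h2u _ (by omega)]
      · have hne : ¬ m - 1 = v - 1 := by omega
        have hne' : ¬ m - 1 = v := by omega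
        simp only [if_true, Nat.reduceAdd, one_ne_zero, if_false, h, OfNat.ofNat_ne_zero, OfNat.ofNat_ne_one, hne, hne']
        rw [show 2 * (m-1) + 3 = n - 1 by omega, h2n]
    · intro k l hl
      have hk := k.2
      have hl3 : (l = 1 ∧ (k:ℕ) ≠ v-1 ∧ (k:ℕ) ≠ m-1) ∨ (l = 2 ∧ (k:ℕ) = v-1) ∨ (l = 2 ∧ (k:ℕ) = m-1) := by
        simp only [s] at hl
        split_ifs at hl <;> omega
      rcases hl3 with ⟨rfl, h1, h2⟩ | ⟨rfl, h⟩ | ⟨rfl, h⟩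
      · simp only [if_true, one_ne_zero, if_false]
        split_ifs with h
        · rw [Matrix.mulVec_sub, h2u _ (by omega), h2u _ (by omega), sub_self]
        · rw [h2o _ (by omega) (by omega) (by omega) (by omega) (by omega)]
      · simp only [if_true, if_false, h, OfNat.ofNat_ne_zero, OfNat.ofNat_ne_one]
        rw [Matrix.mulVec_neg, h2o _ (by omega) (by omega) (by omega) (by omega) (by omega), neg_zero]
      · have hne : ¬ m - 1 = v - 1 := by omega
        simp only [if_false, h, OfNat.ofNat_ne_zero, OfNat.ofNat_ne_one, hne]
        rw [Matrix.mulVec_add, Matrix.mulVec_add, Matrix.mulVec_smul, h2u _ (by omega), h2u _ (by omega), h2e 0 (by omega) (by omega)]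
        rw [two_smul]; abel
    · intro W hW
      have hbig' : ∀ i, 2 ≤ i → i < n → i ≠ 2*v+2 → i ≠ 2*v+3 → ev n i ∈ W := by
        intro i h1 h2 h3 h4
        have := hW ⟨(i-2)/2, by omega⟩ (i % 2) (by simp only [s]; omega)
        have hne : ¬ (i-2)/2 = v := by omega
        rcases Nat.mod_two_eq_zero_or_one i with h | h
        · simp only [h, if_true, hne, if_false] at this
          rwa [show 2 * ((i-2)/2) + 2 = i by omega] at this
        · simp only [h, if_true, one_ne_zero, if_false, hne] at this
          rwa [show 2 * ((i-2)/2) + 3 = i by omega] at this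
      have hu1 : ev n (2*v+2) ∈ W := by
        have := hW ⟨v, by omega⟩ 0 (by simp only [s]; omega)
        simp only [if_true] at this
        exact (Submodule.sub_mem_iff_left _ (hbig' _ (by omega) (by omega) (by omega) (by omega))).1 this
      have hu2 : ev n (2*v+3) ∈ W := by
        have := hW ⟨v, by omega⟩ 1 (by simp only [s]; omega)
        simp only [if_true, one_ne_zero, if_false] at this
        exact (Submodule.sub_mem_iff_left _ (hbig' _ (by omega) (by omega) (by omega) (by omega))).1 this
      have hbig : ∀ i, 2 ≤ i → i < n → ev n i ∈ W := by
        intro i h1 h2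
        by_cases h3 : i = 2*v+2
        · rw [h3]; exact hu1
        by_cases h4 : i = 2*v+3
        · rw [h4]; exact hu2
        exact hbig' i h1 h2 h3 h4
      have h1 : ev n 1 ∈ W := by
        have := hW ⟨v-1, by omega⟩ 2 (by simp only [s, if_true]; omega)
        simp only [if_true, OfNat.ofNat_ne_zero, OfNat.ofNat_ne_one, if_false] at this
        exact (Submodule.neg_mem_iff _).1 this
      have h0 : ev n 0 ∈ W := by
        have := hW ⟨m-1, by omega⟩ 2 (by simp only [s, if_true]; omega)
        simp only [if_neg (show ¬ m - 1 = v - 1 by omega), OfNat.ofNat_ne_zero, OfNat.ofNat_ne_one, if_false] at this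
        have := (Submodule.add_mem_iff_right _ (W.add_mem (hbig _ (by omega) (by omega)) (hbig _ (by omega) (by omega)))).1 this
        exact (Submodule.smul_mem_iff _ two_ne_zero).1 this
      apply ev_top
      intro i hi
      rcases (by omega : i = 0 ∨ i = 1 ∨ 2 ≤ i) with rfl | rfl | h
      · exact h0
      · exact h1
      · exact hbig i h hi
  · intro i hi x hx
    simp only [c3] at hx
    split_ifs at hx with h1 h2
    · have hx0 : (x:ℕ) = 2 ∨ (x:ℕ) = 0 := by
        by_contra hc
        push Not at hc
        apply hx
        simp [ev, hc.1, hc.2]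
      exact ⟨⟨m, le_refl _, by beta_reduce; omega⟩, fun k hk => by beta_reduce; omega⟩
    · simp at hx
    · have hx0 := ev_ne hx
      exact ⟨⟨i/2, by omega, by beta_reduce; omega⟩, fun k hk => by beta_reduce; omega⟩
  · intro l hl
    rcases (by omega : l < 2*v+1 ∨ l = 2*v+1 ∨ l = 2*v+2 ∨ l = 2*v+3 ∨ (2*v+3 < l ∧ l < n - 2) ∨ l = n-2) with h | h | h | h | ⟨h, h'⟩ | h
    · rw [hy1 _ (by omega), hy1 _ (by omega), hS l hl (by omega) (by omega)]
    · rw [hy1 _ (by omega), hy2 _ (by omega) (by omega), hSu _ (by omega)]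
      congr 2; omega
    · rw [hy2 _ (by omega) (by omega), hy2 _ (by omega) (by omega), Matrix.mulVec_sub, hS l hl (by omega) (by omega), hS _ (by omega) (by omega) (by omega)]
      congr 2; omega
    · rw [hy2 _ (by omega) (by omega), hy3 _ (by omega) (by omega), Matrix.mulVec_sub, hSu l (by omega), hS _ (by omega) (by omega) (by omega)]
      rw [show l + 1 - (2*v+1) = l - (2*v+1) + 1 by omega, show l + 1 - (2*v+3) = 1 by omega]
      abel
    · rw [hy3 _ (by omega) (by omega), hy3 _ (by omega) (by omega), Matrix.mulVec_sub, Matrix.mulVec_sub, hS l (by omega) (by omega) (by omega),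
        hS _ (by omega) (by omega) (by omega), hS _ (by omega) (by omega) (by omega)]
      rw [show l + 1 - (2*v+1) = l - (2*v+1) + 1 by omega, show l + 1 - (2*v+3) = l - (2*v+3) + 1 by omega]
    · rw [show l + 1 = n - 1 by omega, hy3 _ (by omega) (by omega), hyn, Matrix.mulVec_sub, Matrix.mulVec_sub, hS l (by omega) (by omega) (by omega),
        hSu (l - (2*v+1)) (by omega), hS _ (by omega) (by omega) (by omega)]
      rw [show l - (2*v+1) + 1 = 2*v+2 by omega, show l - (2*v+3) + 1 = 2*v by omega, show l + 1 = n - 1 by omega]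
      abel
  · rw [hyn, Matrix.mulVec_add, Matrix.mulVec_sub, Matrix.mulVec_sub, hSn, hS _ (by omega) (by omega) (by omega),
      hS (2*v) (by omega) (by omega) (by omega), hS 1 (by omega) (by omega) (by omega)]
    abel
  · apply tri_span
    intro l hl W hW hyl
    rcases (by omega : l ≤ 2*v+1 ∨ (2*v+1 < l ∧ l ≤ 2*v+3) ∨ (2*v+3 < l ∧ l < n-1) ∨ l = n - 1) with h | ⟨h, h'⟩ | ⟨h, h'⟩ | h
    · rwa [hy1 _ h] at hyl
    · rw [hy2 _ h h'] at hyl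
      exact (Submodule.sub_mem_iff_left _ (hW _ (by omega))).1 hyl
    · rw [hy3 _ h h'] at hyl
      exact (Submodule.sub_mem_iff_left _ (hW _ (by omega))).1 ((Submodule.sub_mem_iff_left _ (hW _ (by omega))).1 hyl)
    · subst h
      rw [hyn] at hyl
      exact (Submodule.sub_mem_iff_left _ (hW _ (by omega))).1 ((Submodule.sub_mem_iff_left _ (hW _ (by omega))).1
        ((Submodule.add_mem_iff_left _ (hW _ (by omega))).1 hyl))
  · intro l h1 h2
    rcases (by omega : l ≤ 2*v+1 ∨ (2*v+1 < l ∧ l ≤ 2*v+3) ∨ (2*v+3 < l ∧ l < n-1) ∨ l = n - 1) with h | ⟨h, h'⟩ | ⟨h, h'⟩ | h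
    · rw [hy1 _ h, ev0 _ (by omega)]
    · rw [hy2 _ h h', Pi.sub_apply, ev0 _ (by omega), ev0 _ (by omega), sub_zero]
    · rw [hy3 _ h h', Pi.sub_apply, Pi.sub_apply, ev0 _ (by omega), ev0 _ (by omega), ev0 _ (by omega)]; simp
    · rw [h, hyn, Pi.add_apply, Pi.sub_apply, Pi.sub_apply, ev0 _ (by omega), ev0 _ (by omega), ev0 _ (by omega), ev0 _ (by omega)]; simp
  · rw [hyn, Matrix.mulVec_add, Matrix.mulVec_sub, Matrix.mulVec_sub, h2n, h2e _ (by omega) (by omega), h2e _ (by omega) (by omega),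
      h2o 1 (by omega) (by omega) (by omega) (by omega) (by omega)]
    simp [ev]

end F1ce

section F1b

noncomputable def yv (n : ℕ) : ℕ → Fin n → ℂ
  | 0 => ev n 0
  | 1 => ev n 1
  | 2 => ev n 2
  | 3 => ev n 3
  | 4 => ev n 4
  | (l+5) => ev n (l+5) - yv n (l+2)

lemma yv_small (n l : ℕ) (h : l < 5) : yv n l = ev n l := by
  interval_cases l <;> rfl

lemma yv_big (n l : ℕ) (h : 5 ≤ l) : yv n l = ev n l - yv n (l-3) := by
  obtain ⟨k, rfl⟩ := Nat.exists_eq_add_of_le' h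
  rfl

lemma yv_supp (n l : ℕ) (x : Fin n) (h : l < (x:ℕ)) : yv n l x = 0 := by
  induction l using Nat.strong_induction_on with
  | _ l ih =>
    rcases Nat.lt_or_ge l 5 with h1 | h1
    · rw [yv_small _ _ h1]; simp only [ev]; rw [if_neg (by omega)]
    · rw [yv_big _ _ h1, Pi.sub_apply, ih (l-3) (by omega) (by omega)]
      simp only [ev]; rw [if_neg (by omega)]; simp

lemma yv_diag (n l : ℕ) (x : Fin n) (h : (x:ℕ) = l) : yv n l x = 1 := by
  rcases Nat.lt_or_ge l 5 with h1 | h1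
  · rw [yv_small _ _ h1]; simp only [ev]; rw [if_pos (by omega)]
  · rw [yv_big _ _ h1, Pi.sub_apply, yv_supp _ _ _ (by omega)]
    simp only [ev]; rw [if_pos (by omega)]; simp

lemma yv_zero (n l : ℕ) (hn : 0 < n) (h : 1 ≤ l) : yv n l ⟨0, hn⟩ = 0 := by
  induction l using Nat.strong_induction_on with
  | _ l ih =>
    rcases Nat.lt_or_ge l 5 with h1 | h1
    · rw [yv_small _ _ h1, ev0 _ (by omega)]
    · rw [yv_big _ _ h1, Pi.sub_apply, ih (l-3) (by omega) (by omega), ev0 _ (by omega), sub_zero]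

lemma yv_mem (n l : ℕ) (W : Submodule ℂ (Fin n → ℂ)) (h : ∀ i ≤ l, ev n i ∈ W) : yv n l ∈ W := by
  induction l using Nat.strong_induction_on with
  | _ l ih =>
    rcases Nat.lt_or_ge l 5 with h1 | h1
    · rw [yv_small _ _ h1]; exact h l le_rfl
    · rw [yv_big _ _ h1]
      exact W.sub_mem (h l le_rfl) (ih (l-3) (by omega) (fun i hi => h i (by omega)))

lemma colM_mulVec {n : ℕ} (c : ℕ → Fin n → ℂ) (v : Fin n → ℂ) : colM c *ᵥ v = ∑ x : Fin n, v x • c x := by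
  ext z
  simp [Matrix.mulVec, dotProduct, colM, mul_comm]

lemma F1b {n m h : ℕ} (hn : 0 < n) (hh1 : 1 ≤ h) (hh2 : h + 2 ≤ m) (hnm : n = 2 * m + 2 + h) : DataI n m hn := by
  classical
  let E : ℕ → ℕ := fun k => 1 + 2 * k + min k h
  have hE0 : E 0 = 1 := by simp [E]
  have hE1 : E 1 = 4 := by simp only [E]; omega
  have hEm : E m = n - 1 := by simp only [E]; omega
  have hEm1 : E (m-1) = n - 3 := by simp only [E]; omega
  have hEm2 : E (m-2) = n - 5 := by simp only [E]; omega
  have hEs : ∀ k, E (k+1) = E k + 2 + if k < h then 1 else 0 := by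
    intro k; simp only [E]; split_ifs <;> omega
  have hmono : Monotone E := monotone_nat_of_le_succ (fun k => by have := hEs k; omega)
  let PL : ℕ → Prop := fun i => ∃ k ≤ m, i = E k
  have hPL1 : ∀ k i, E k < i → i < E (k+1) → ¬ PL i := by
    rintro k i h1 h2 ⟨k', hk', rfl⟩
    rcases Nat.lt_or_ge k' (k+1) with h | h
    · have := hmono (show k' ≤ k by omega); omega
    · have := hmono h; omega
  have hPL0 : ¬ PL 0 := by rintro ⟨k, _, h⟩; simp only [E] at h; omega
  have hPLs : ∀ k, k ≤ m → ¬ PL (E k + 1) := by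
    intro k hk
    have := hEs k
    exact hPL1 k _ (by omega) (by omega)
  have hPL2 : ¬ PL 2 := by have := hPLs 0 (by omega); rwa [hE0] at this
  have hPL4 : PL 4 := ⟨1, by omega, hE1.symm⟩
  have hPLn1 : PL (n-1) := ⟨m, le_rfl, hEm.symm⟩
  have hPLn3 : PL (n-3) := ⟨m-1, by omega, hEm1.symm⟩
  have hPL11 : PL 1 := ⟨0, by omega, hE0.symm⟩
  let τ : Fin n → ℂ := yv n (n-3) + ev n 3
  let τL : Fin n → ℂ := fun x => if PL x then τ x else 0
  let τN : Fin n → ℂ := fun x => if PL x then 0 else τ x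
  have hτ : τL + τN = τ := by
    ext x; simp only [Pi.add_apply, τL, τN]; split_ifs <;> simp
  have hτn : ∀ x : Fin n, n - 3 < (x:ℕ) → τ x = 0 := by
    intro x hx
    simp only [τ, Pi.add_apply]
    rw [yv_supp _ _ _ hx]
    simp only [ev]
    rw [if_neg (by omega)]; simp
  have hτ3 : ∀ x : Fin n, (x:ℕ) = n-3 → τ x = 1 := by
    intro x hx
    simp only [τ, Pi.add_apply]
    rw [yv_diag _ _ _ hx]
    simp only [ev]
    rw [if_neg (by omega)]; simp
  let c2 : ℕ → Fin n → ℂ := fun i => if i = n - 1 then τL + ev n 0 else if i = n-3 then - ev n 1 else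
    if PL i then 0 else ev n (i+1)
  let c3 : ℕ → Fin n → ℂ := fun i => if i = n - 1 then τN - ev n 0 else if i = 4 then ev n 5 - ev n 2 else
    if PL i then ev n (i+1) else 0
  have h2n : c2 (n-1) = τL + ev n 0 := by simp only [c2, if_true]
  have h23 : c2 (n-3) = - ev n 1 := by simp only [c2, if_true]; rw [if_neg (by omega)]
  have h2L : ∀ i, i ≠ n-1 → i ≠ n-3 → PL i → c2 i = 0 := by
    intro i h1 h2 h3; simp only [c2, if_neg h1, if_neg h2, if_pos h3]
  have h2N : ∀ i, ¬ PL i → c2 i = ev n (i+1) := by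
    intro i h1; simp only [c2]
    rw [if_neg (fun hc : i = n-1 => h1 (hc ▸ hPLn1)), if_neg (fun hc : i = n-3 => h1 (hc ▸ hPLn3)), if_neg h1]
  have hSn : colM (c2 + c3) *ᵥ ev n (n-1) = τ := by
    rw [colM_ev _ _ (by omega)]
    simp only [Pi.add_apply, h2n, c3, if_true]
    rw [← hτ]; abel
  have hS3 : colM (c2 + c3) *ᵥ ev n (n-3) = ev n (n-2) - ev n 1 := by
    rw [colM_ev _ _ (by omega)]
    simp only [Pi.add_apply, h23, c3]
    rw [if_neg (by omega), if_neg (by omega), if_pos hPLn3, show n - 3 + 1 = n - 2 by omega]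
    abel
  have hS4 : colM (c2 + c3) *ᵥ ev n 4 = ev n 5 - ev n 2 := by
    rw [colM_ev _ _ (by omega)]
    simp only [Pi.add_apply, c3]
    rw [h2L 4 (by omega) (by omega) hPL4, if_neg (by omega)]
    simp
  have hS : ∀ i, i + 1 < n → i ≠ n-3 → i ≠ 4 → colM (c2 + c3) *ᵥ ev n i = ev n (i+1) := by
    intro i hi h1 h2
    rw [colM_ev _ _ (by omega)]
    simp only [Pi.add_apply, c3, if_neg h2, if_neg (show i ≠ n - 1 by omega)]
    by_cases hP : PL i
    · rw [h2L i (by omega) h1 hP, if_pos hP]; simp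
    · rw [h2N i hP, if_neg hP]; simp
  have hSy : ∀ l, l + 3 < n → colM (c2 + c3) *ᵥ yv n l = yv n (l+1) := by
    intro l
    induction l using Nat.strong_induction_on with
    | _ l ih =>
      intro hl
      rcases (by omega : l < 4 ∨ l = 4 ∨ 5 ≤ l) with h | h | h
      · rw [yv_small _ _ (by omega), yv_small _ _ (by omega), hS _ (by omega) (by omega) (by omega)]
      · subst h
        rw [yv_small _ _ (by omega), hS4, yv_big _ 5 (by omega), yv_small _ 2 (by omega)]
      · rw [yv_big _ l h, yv_big _ (l+1) (by omega), Matrix.mulVec_sub, hS _ (by omega) (by omega) (by omega),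
          ih (l-3) (by omega) (by omega), show l + 1 - 3 = l - 3 + 1 by omega]
  let z : ℕ → Fin n → ℂ := fun l => if l = n - 1 then yv n (n-1) - ev n 2 else if l = n - 2 then yv n (n-2) - ev n 1 else yv n l
  have hz1 : z (n-1) = yv n (n-1) - ev n 2 := by simp only [z, if_true]
  have hz2 : z (n-2) = yv n (n-2) - ev n 1 := by simp only [z, if_true]; rw [if_neg (by omega)]
  have hz : ∀ l, l + 2 < n → z l = yv n l := by
    intro l hl; simp only [z]; rw [if_neg (by omega), if_neg (by omega)]
  refine ⟨c2, c3, E, z, ?_, ?_, ?_, ?_, ?_, ?_, ?_⟩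
  · let s : ℕ → ℕ := fun k => 2 + (if k < h then 1 else 0) + (if k = m-2 then 1 else 0) + (if k = m-1 then 1 else 0)
    have hs1 : ∀ k, k + 2 < m → E k + s k = E (k+1) := by
      intro k hk; rw [hEs]; simp only [s]; rw [if_neg (show k ≠ m-2 by omega), if_neg (show k ≠ m-1 by omega)]; omega
    have hs2 : s (m-2) = 3 := by
      simp only [s]; rw [if_neg (by omega), if_pos trivial, if_neg (by omega)]
    have hs3 : s (m-1) = 3 := by
      simp only [s]; rw [if_neg (by omega), if_neg (by omega), if_pos trivial]
    apply cone_of_chains (ι := Fin m) (by simp) (colM c2) (fun k => s k)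
      (fun k l => if (k:ℕ) = m-2 ∧ l = 2 then - ev n 1 else if (k:ℕ) = m-1 ∧ l = 2 then τL + ev n 0 else ev n (E k + 1 + l))
    · rw [Fin.sum_univ_eq_sum_range s m]
      simp only [s]
      rw [Finset.sum_add_distrib, Finset.sum_add_distrib, Finset.sum_add_distrib, Finset.sum_ite_eq', Finset.sum_ite_eq',
        if_pos (Finset.mem_range.2 (by omega)), if_pos (Finset.mem_range.2 (by omega)), Finset.sum_boole]
      have : (Finset.range m).filter (fun k => k < h) = Finset.range h := by
        ext k; simp only [Finset.mem_filter, Finset.mem_range]; omega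
      rw [this]
      simp; omega
    · intro i j
      have : ∀ k, 2 ≤ s k ∧ s k ≤ 3 := by
        intro k; simp only [s]; split_ifs <;> omega
      have h1 := this i
      have h2 := this j
      beta_reduce
      omega
    · intro k l hl
      have hk := k.2
      have hEk := hEs k
      beta_reduce at hl ⊢
      rcases (by omega : (k:ℕ) + 2 < m ∨ (k:ℕ) = m-2 ∨ (k:ℕ) = m-1) with h1 | h1 | h1
      · have h2 := hs1 k h1
        have hEb := hmono (show (k:ℕ) + 1 ≤ m by omega)
        rw [if_neg (by omega), if_neg (by omega), if_neg (by omega), if_neg (by omega), colM_ev _ _ (by omega), h2N _ (hPL1 k _ (by omega) (by omega))]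
        rfl
      · rw [h1, hs2] at hl
        have hEk2 := hEs (m-2)
        rw [if_neg (show ¬ m - 2 < h by omega)] at hEk2
        rcases (by omega : l = 0 ∨ l = 1) with rfl | rfl
        · rw [if_neg (by omega), if_neg (by omega), if_neg (by omega), if_neg (by omega), h1, colM_ev _ _ (by omega), h2N _ (hPL1 (m-2) _ (by omega) (by omega))]
        · rw [if_neg (by omega), if_neg (by omega), if_pos ⟨h1, rfl⟩, h1, show E (m-2) + 1 + 1 = n - 3 by omega, colM_ev _ _ (by omega), h23]
      · rw [h1, hs3] at hl
        have hEk2 := hEs (m-1)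
        rw [if_neg (show ¬ m - 1 < h by omega)] at hEk2
        rcases (by omega : l = 0 ∨ l = 1) with rfl | rfl
        · rw [if_neg (by omega), if_neg (by omega), if_neg (by omega), if_neg (by omega), h1, colM_ev _ _ (by omega), h2N _ (hPL1 (m-1) _ (by omega) (by omega))]
        · rw [if_neg (by omega), if_neg (by omega), if_neg (by omega), if_pos ⟨h1, rfl⟩, h1, show E (m-1) + 1 + 1 = n - 1 by omega, colM_ev _ _ (by omega), h2n]
    · intro k l hl
      have hk := k.2
      beta_reduce at hl ⊢
      rcases (by omega : (k:ℕ) + 2 < m ∨ (k:ℕ) = m-2 ∨ (k:ℕ) = m-1) with h1 | h1 | h1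
      · have h2 := hs1 k h1
        have hEb := hmono (show (k:ℕ) + 1 ≤ m - 2 by omega)
        rw [if_neg (by omega), if_neg (by omega), show E k + 1 + l = E (k+1) by omega, colM_ev _ _ (by omega),
          h2L _ (by omega) (by omega) ⟨k+1, by omega, rfl⟩]
      · rw [h1, hs2] at hl
        rw [if_pos ⟨h1, by omega⟩, Matrix.mulVec_neg, colM_ev _ _ (by omega), h2L 1 (by omega) (by omega) hPL11, neg_zero]
      · rw [h1, hs3] at hl
        rw [if_neg (by omega), if_pos ⟨h1, by omega⟩, Matrix.mulVec_add, colM_ev _ _ (by omega), h2N 0 hPL0, colM_mulVec,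
          Fintype.sum_eq_single (⟨n-3, by omega⟩ : Fin n)]
        · simp only [τL, if_pos hPLn3, h23]
          rw [hτ3 _ rfl]; simp
        · intro x hx
          have hx' : (x:ℕ) ≠ n - 3 := fun h => hx (Fin.ext h)
          simp only [τL]
          split_ifs with h3
          · by_cases h4 : (x:ℕ) = n - 1
            · rw [hτn x (by omega), zero_smul]
            · rw [h2L _ h4 hx' h3, smul_zero]
          · rw [zero_smul]
    · intro W hW
      have hbig : ∀ i, 2 ≤ i → i < n → ev n i ∈ W := by
        intro i hi1 hi2
        have hstep : ∀ q : ℕ, i - 2 < q → ∃ k, E k ≤ i - 1 ∧ i - 1 < E (k+1) := by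
          intro q _
          have := step_find (fun k => E k - 1) (by simp [hE0]) (i-2) m (by beta_reduce; omega)
          obtain ⟨k, hk, h1, h2⟩ := this
          have hk0 := hmono (Nat.zero_le k)
          exact ⟨k, by omega, by omega⟩
        obtain ⟨k, h1, h2⟩ := hstep (i-1) (by omega)
        have hkm : k < m := by
          by_contra hc
          have := hmono (show m ≤ k by omega)
          omega
        have hEk := hEs k
        have hsk : i - 1 - E k < s k := by
          have : E (k+1) ≤ E k + s k := by rw [hEs]; simp only [s]; omega
          omega
        have := hW ⟨k, hkm⟩ (i - 1 - E k) hsk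
        beta_reduce at this
        rw [if_neg (by
          rintro ⟨h3, h4⟩
          simp only at h3
          rw [if_neg (show ¬ k < h by omega)] at hEk
          omega), if_neg (by
          rintro ⟨h3, h4⟩
          simp only at h3
          rw [if_neg (show ¬ k < h by omega)] at hEk
          omega)] at this
        simp only at this
        rwa [show E k + 1 + (i - 1 - E k) = i by omega] at this
      have h1 : ev n 1 ∈ W := by
        have := hW ⟨m-2, by omega⟩ 2 (by beta_reduce; simp only [hs2]; omega)
        simp only [and_self, if_true] at this
        exact (Submodule.neg_mem_iff _).1 this
      have h0 : ev n 0 ∈ W := by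
        have := hW ⟨m-1, by omega⟩ 2 (by beta_reduce; simp only [hs3]; omega)
        simp only [if_neg (show ¬ (m - 1 = m - 2 ∧ True) by omega), and_self, if_true] at this
        refine (Submodule.add_mem_iff_right _ ?_).1 this
        have hτs : τL = ∑ x : Fin n, τL x • ev n x := by
          rw [← Finset.univ_sum_single τL]
          apply Finset.sum_congr rfl
          intro x _
          rw [ev_eq_single, ← Pi.single_smul]
          simp
        rw [hτs]
        apply Submodule.sum_mem
        intro x _
        by_cases hx0 : (x:ℕ) = 0
        · have : τL x = 0 := by
            simp only [τL]; rw [hx0, if_neg hPL0]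
          rw [this, zero_smul]; exact W.zero_mem
        · apply W.smul_mem
          by_cases hx1 : (x:ℕ) = 1
          · rw [hx1]; exact h1
          · exact hbig x (by omega) x.2
      apply ev_top
      intro i hi
      rcases (by omega : i = 0 ∨ i = 1 ∨ 2 ≤ i) with rfl | rfl | h
      · exact h0
      · exact h1
      · exact hbig i h hi
  · intro i hi x hx
    have hnot : ¬ PL x → ∀ k ≤ m, (x:ℕ) ≠ E k := fun h k hk hc => h ⟨k, hk, hc⟩
    simp only [c3] at hx
    split_ifs at hx with h1 h2 h3
    · refine ⟨h1 ▸ hPLn1, hnot ?_⟩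
      intro hP
      apply hx
      have : (x:ℕ) ≠ 0 := fun h => hPL0 (h ▸ hP)
      simp only [Pi.sub_apply, τN, if_pos hP, ev]
      rw [if_neg this]; simp
    · refine ⟨h2 ▸ hPL4, hnot ?_⟩
      have hx0 : (x:ℕ) = 5 ∨ (x:ℕ) = 2 := by
        by_contra hc
        push Not at hc
        apply hx
        simp [ev, hc.1, hc.2]
      rcases hx0 with h | h
      · rw [h]; have := hPLs 1 (by omega); rwa [hE1] at this
      · rw [h]; exact hPL2
    · refine ⟨h3, hnot ?_⟩
      obtain ⟨k, hk, rfl⟩ := h3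
      rw [ev_ne hx]; exact hPLs k hk
    · simp at hx
  · intro l hl
    rcases (by omega : l + 3 < n ∨ l = n - 3 ∨ l = n - 2) with h1 | h1 | h1
    · rw [hz l (by omega), hz (l+1) (by omega), hSy l h1]
    · subst h1
      rw [hz _ (by omega), show n - 3 + 1 = n - 2 by omega, hz2, yv_big _ (n-3) (by omega), yv_big _ (n-2) (by omega),
        Matrix.mulVec_sub, hS3, hSy _ (by omega), show n - 3 - 3 + 1 = n - 2 - 3 by omega]
      abel
    · subst h1
      rw [hz2, show n - 2 + 1 = n - 1 by omega, hz1, yv_big _ (n-2) (by omega), yv_big _ (n-1) (by omega),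
        Matrix.mulVec_sub, Matrix.mulVec_sub, hS _ (by omega) (by omega) (by omega), hS _ (by omega) (by omega) (by omega),
        hSy _ (by omega), show n - 2 - 3 + 1 = n - 1 - 3 by omega, show n - 2 + 1 = n - 1 by omega]
  · rw [hz1, yv_big _ (n-1) (by omega), Matrix.mulVec_sub, Matrix.mulVec_sub, hSn, hS _ (by omega) (by omega) (by omega),
      hSy _ (by omega), show n - 1 - 3 + 1 = n - 3 by omega]
    simp [τ]
  · apply tri_span
    intro l hl W hW hyl
    have key : yv n l ∈ W → ev n l ∈ W := by
      intro h1
      rcases Nat.lt_or_ge l 5 with h5 | h5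
      · rwa [yv_small _ _ h5] at h1
      · rw [yv_big _ _ h5] at h1
        exact (Submodule.sub_mem_iff_left _ (yv_mem _ _ _ (fun i hi => hW i (by omega)))).1 h1
    apply key
    rcases (by omega : l + 2 < n ∨ l = n - 2 ∨ l = n - 1) with h1 | h1 | h1
    · rwa [hz l h1] at hyl
    · subst h1
      rw [hz2] at hyl
      exact (Submodule.sub_mem_iff_left _ (hW _ (by omega))).1 hyl
    · subst h1
      rw [hz1] at hyl
      exact (Submodule.sub_mem_iff_left _ (hW _ (by omega))).1 hyl
  · intro l h1 h2
    rcases (by omega : l + 2 < n ∨ l = n - 2 ∨ l = n - 1) with h3 | h3 | h3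
    · rw [hz l h3, yv_zero _ _ _ h1]
    · rw [h3, hz2, Pi.sub_apply, yv_zero _ _ _ (by omega), ev0 _ (by omega), sub_zero]
    · rw [h3, hz1, Pi.sub_apply, yv_zero _ _ _ (by omega), ev0 _ (by omega), sub_zero]
  · have hrow : ∀ l, l < n - 1 → (colM c2 *ᵥ ev n l) ⟨0, hn⟩ = 0 := by
      intro l hl
      rw [colM_ev _ _ (by omega)]
      simp only [c2]
      rw [if_neg (by omega)]
      split_ifs
      · rw [Pi.neg_apply, ev0 _ (by omega), neg_zero]
      · rfl
      · rw [ev0 _ (by omega)]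
    have hrowy : ∀ l, l < n - 1 → (colM c2 *ᵥ yv n l) ⟨0, hn⟩ = 0 := by
      intro l
      induction l using Nat.strong_induction_on with
      | _ l ih =>
        intro hl
        rcases Nat.lt_or_ge l 5 with h5 | h5
        · rw [yv_small _ _ h5, hrow l hl]
        · rw [yv_big _ _ h5, Matrix.mulVec_sub, Pi.sub_apply, hrow l hl, ih _ (by omega) (by omega), sub_zero]
    rw [hz1, yv_big _ (n-1) (by omega), Matrix.mulVec_sub, Matrix.mulVec_sub, Pi.sub_apply, Pi.sub_apply,
      hrow 2 (by omega), hrowy _ (by omega), colM_ev _ _ (by omega), h2n, Pi.add_apply, ev00]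
    have : τL ⟨0, hn⟩ = 0 := by simp only [τL]; rw [if_neg hPL0]
    rw [this]; simp

end F1b

section CaseIII

lemma dataI_all {n m : ℕ} (hn : 0 < n) (hm : 0 < m) (h : 2 * m + 2 ≤ n) : DataI n m hn := by
  by_cases h1 : 3 * m + 1 ≤ n
  · exact F1a hn hm h1
  by_cases h2 : n = 2 * m + 2
  · rcases Nat.even_or_odd' m with ⟨v, hv | hv⟩
    · exact F1c_odd hn (v := v) (by omega) hv (by omega)
    · exact F1c_even hn (v := v) (by omega) hv (by omega)
  · exact F1b hn (h := n - 2 * m - 2) (by omega) (by omega) (by omega)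

lemma intervals {p : ℕ} (r : Fin p → ℕ) (M : ℕ) (hM : ∑ j, r j = M) (hp : 0 < p) :
    ∃ (a : Fin p → ℕ) (c : ℕ → Fin p), ∀ i < M, a (c i) ≤ i ∧ i < a (c i) + r (c i) := by
  let R : ℕ → ℕ := fun i => if h : i < p then r ⟨i, h⟩ else 0
  let q : ℕ → ℕ := fun k => ∑ i ∈ Finset.range k, R i
  have hq : q p = M := by
    rw [← hM]; simp only [q]
    rw [Finset.sum_range]
    apply Finset.sum_congr rfl
    intro j _
    simp [R]
  have hex : ∀ i, ∃ j : Fin p, i < M → q j ≤ i ∧ i < q j + r j := by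
    intro i
    by_cases hi : i < M
    · obtain ⟨k, hk, h1, h2⟩ := step_find q (by simp [q]) i p (by omega)
      refine ⟨⟨k, hk⟩, fun _ => ⟨h1, ?_⟩⟩
      have : q (k+1) = q k + r ⟨k, hk⟩ := by
        simp only [q]; rw [Finset.sum_range_succ]; simp [R, hk]
      rw [this] at h2; exact h2
    · exact ⟨⟨0, hp⟩, fun h => absurd h hi⟩
  choose c hc using hex
  exact ⟨fun j => q j, c, fun i hi => hc i hi⟩

lemma slots {n p : ℕ} (hn : 0 < n) (hn2 : 2 ≤ n) (r : Fin p → ℕ) (hr : ∀ j, 2 * r j ≤ n) (C : ℕ → Fin p)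
    (a : Fin p → ℕ) (idx : ℕ → ℕ) (hidx : ∀ s ≤ n, a (C s) ≤ idx s ∧ idx s < a (C s) + r (C s))
    (hinj : ∀ s ≤ n, ∀ s' ≤ n, idx s = idx s' → s = s')
    (h1 : ∀ s, 1 ≤ s → s + 1 < n → C s ≠ C (s+1)) (h2 : C (n-1) ≠ C 0) (h3 : C (n-1) ≠ C n)
    (h4 : C 1 ≠ C 0) (h5 : C 1 ≠ C n) (h6 : C 0 ≠ C n) : Good n p hn r := by
  classical
  let d : Fin p → ℕ → Fin n → ℂ := fun j i => if i + 1 < n then (if C (i+1) = j then ev n (i+1) else 0) else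
    ((if C 0 = j then ev n 0 else 0) - (if C n = j then ev n 0 else 0))
  have hsum : ∀ i, ∑ j, d j i = if i + 1 < n then ev n (i+1) else 0 := by
    intro i
    simp only [d]
    split_ifs with h
    · simp
    · rw [Finset.sum_sub_distrib]; simp
  refine ⟨fun j => colM (d j), fun l => ev n l, ?_, ?_, ?_, ?_, ?_, C 0, ?_⟩
  · intro j
    let L : Finset (Fin n) := Finset.univ.filter (fun x => if (x:ℕ) + 1 < n then C (x+1) = j else (C 0 = j ∨ C n = j))
    let sl : Fin n → ℕ := fun x => if (x:ℕ) + 1 < n then (x:ℕ) + 1 else if C 0 = j then 0 else n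
    have hsl : ∀ x ∈ L, sl x ≤ n ∧ C (sl x) = j := by
      intro x hx
      simp only [L, Finset.mem_filter, Finset.mem_univ, true_and] at hx
      simp only [sl]
      split_ifs at hx ⊢ with g1 g2
      · exact ⟨by omega, hx⟩
      · exact ⟨by omega, g2⟩
      · exact ⟨le_rfl, by tauto⟩
    have hcard : L.card ≤ r j := by
      have : L.card ≤ (Finset.Ico (a j) (a j + r j)).card := by
        apply Finset.card_le_card_of_injOn (fun x => idx (sl x))
        · intro x hx
          obtain ⟨g1, g2⟩ := hsl x hx
          have := hidx _ g1
          rw [g2] at this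
          simpa using this
        · intro x hx x' hx' hxx
          have := hinj _ (hsl x hx).1 _ (hsl x' hx').1 hxx
          apply Fin.ext
          have e1 := x.2
          have e2 := x'.2
          simp only [sl] at this
          split_ifs at this <;> omega
      simpa using this
    apply Ty_bip _ L hcard (by have := hr j; omega)
    intro x i hxi
    have hxi' : d j i x ≠ 0 := hxi
    simp only [d] at hxi'
    simp only [L, Finset.mem_filter, Finset.mem_univ, true_and]
    by_cases g1 : (i:ℕ) + 1 < n
    · rw [if_pos g1] at hxi'
      by_cases g2 : C (i+1) = j
      · rw [if_pos g2] at hxi'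
        have hx := ev_ne hxi'
        refine ⟨by rw [if_pos g1]; exact g2, ?_⟩
        rw [hx]
        split_ifs with g3
        · intro g4; exact h1 (i+1) (by omega) g3 (by rw [g2, g4])
        · have g5 : (i:ℕ) + 1 = n - 1 := by omega
          rw [g5] at g2
          rintro (g | g)
          · exact h2 (by rw [g2, g])
          · exact h3 (by rw [g2, g])
      · rw [if_neg g2] at hxi'; simp at hxi'
    · rw [if_neg g1] at hxi'
      have hx : (x:ℕ) = 0 := by
        by_contra hc
        apply hxi'
        rw [Pi.sub_apply]
        split_ifs <;> simp [ev, hc]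
      have hor : C 0 = j ∨ C n = j := by
        by_contra hc
        push Not at hc
        apply hxi'
        rw [if_neg hc.1, if_neg hc.2]; simp
      refine ⟨by rw [if_neg g1]; exact hor, ?_⟩
      rw [hx, if_pos (by omega)]
      intro g
      rw [zero_add] at g
      rcases hor with g' | g'
      · exact h4 (by rw [g, g'])
      · exact h5 (by rw [g, g'])
  · intro l hl
    rw [colM_sum, colM_ev _ _ (by omega), hsum, if_pos hl]
  · rw [colM_sum, colM_ev _ _ (by omega), hsum, if_neg (by omega)]
  · intro W hW; exact ev_top W hW
  · intro l g1 g2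
    exact ev0 _ (by omega)
  · rw [colM_ev _ _ (by omega)]
    simp only [d]
    rw [if_neg (by omega), if_pos trivial, if_neg (Ne.symm h6)]
    simp [ev00]

lemma caseIII_odd {n k p : ℕ} (hn : 0 < n) (hk : 0 < k) (hnk : n = 2 * k + 1) (r : Fin p → ℕ) (hr : ∀ j, 2 * r j ≤ n)
    (hs : ∑ j, r j = n + 1) (hp : 0 < p) : Good n p hn r := by
  obtain ⟨a, c, hc⟩ := intervals r (n+1) hs hp
  have hdiff : ∀ i j, i < n + 1 → j < n + 1 → i + k ≤ j → c i ≠ c j := by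
    intro i j hi hj hij he
    have h1 := hc i hi
    have h2 := hc j hj
    rw [he] at h1
    have := hr (c j)
    omega
  let idx : ℕ → ℕ := fun s => if s % 2 = 0 then s / 2 else (s + n) / 2
  have hE : ∀ s, s % 2 = 0 → idx s = s / 2 := fun s h => if_pos h
  have hO : ∀ s, s % 2 = 1 → idx s = (s + n) / 2 := fun s h => if_neg (by omega)
  have hb : ∀ s ≤ n, idx s < n + 1 := by
    intro s hs; simp only [idx]; split_ifs <;> omega
  have he : ∀ s s', s ≤ n → s' ≤ n → (idx s + k ≤ idx s' ∨ idx s' + k ≤ idx s) → c (idx s) ≠ c (idx s') := by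
    intro s s' h1 h2 h3
    rcases h3 with h3 | h3
    · exact hdiff _ _ (hb s h1) (hb s' h2) h3
    · exact (hdiff _ _ (hb s' h2) (hb s h1) h3).symm
  refine slots hn (by omega) r hr (fun s => c (idx s)) a idx (fun s hs => hc _ (hb s hs)) ?_ ?_ ?_ ?_ ?_ ?_ ?_
  · intro s hs s' hs' h
    simp only [idx] at h
    split_ifs at h <;> omega
  · intro s h1 h2
    apply he s (s+1) (by omega) (by omega)
    rcases Nat.mod_two_eq_zero_or_one s with g | g
    · rw [hE s g, hO (s+1) (by omega)]; omega
    · rw [hO s g, hE (s+1) (by omega)]; omega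
  · exact he (n-1) 0 (by omega) (by omega) (by rw [hE (n-1) (by omega), hE 0 (by omega)]; omega)
  · exact he (n-1) n (by omega) (by omega) (by rw [hE (n-1) (by omega), hO n (by omega)]; omega)
  · exact he 1 0 (by omega) (by omega) (by rw [hO 1 (by omega), hE 0 (by omega)]; omega)
  · exact he 1 n (by omega) (by omega) (by rw [hO 1 (by omega), hO n (by omega)]; omega)
  · exact he 0 n (by omega) (by omega) (by rw [hE 0 (by omega), hO n (by omega)]; omega)

lemma good_color {k p : ℕ} (hk : 0 < k) (r : Fin p → ℕ) (hr : ∀ j, r j ≤ k) (hs : ∑ j, r j = 2 * k + 1) :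
    ∃ (a : Fin p → ℕ) (c : ℕ → Fin p), (∀ i < 2 * k + 1, a (c i) ≤ i ∧ i < a (c i) + r (c i)) ∧
      ∀ t, 2 ≤ t → t ≤ k → c t ≠ c (t + k - 1) := by
  classical
  have hp : 0 < p := by
    rcases Nat.eq_zero_or_pos p with h | h
    · subst h; simp at hs
    · exact h
  by_cases hA : (∀ j, r j < k) ∨ k = 1
  · obtain ⟨a, c, hc⟩ := intervals r _ hs hp
    refine ⟨a, c, hc, ?_⟩
    intro t h1 h2 he
    have e1 := hc t (by omega)
    have e2 := hc (t+k-1) (by omega)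
    rw [he] at e1
    rcases hA with h | h
    · have := h (c (t+k-1)); omega
    · omega
  push Not at hA
  obtain ⟨⟨j0, hj0⟩, hk1⟩ := hA
  have hj0 : r j0 = k := le_antisymm (hr j0) hj0
  have hrest : ∑ j ∈ Finset.univ.erase j0, r j = k + 1 := by
    have := Finset.add_sum_erase Finset.univ r (Finset.mem_univ j0)
    omega
  by_cases hB : ∃ j1, j1 ≠ j0 ∧ r j1 = k
  · obtain ⟨j1, hne, hj1⟩ := hB
    have hrest2 : ∑ j ∈ (Finset.univ.erase j0).erase j1, r j = 1 := by
      have := Finset.add_sum_erase (Finset.univ.erase j0) r (Finset.mem_erase.2 ⟨hne, Finset.mem_univ j1⟩)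
      omega
    obtain ⟨j2, hj2, hr2⟩ := Finset.exists_ne_zero_of_sum_ne_zero (by rw [hrest2]; omega : ∑ j ∈ (Finset.univ.erase j0).erase j1, r j ≠ 0)
    simp only [Finset.mem_erase, Finset.mem_univ, and_true] at hj2
    refine ⟨fun j => if j = j0 then 0 else if j = j1 then k + 1 else k,
      fun i => if i < k then j0 else if i = k then j2 else j1, ?_, ?_⟩
    · intro i hi
      by_cases g1 : i < k
      · simp only [if_pos g1, if_true]; omega
      · by_cases g2 : i = k
        · simp only [if_neg g1, if_pos g2, if_neg hj2.1, if_neg hj2.2]; omega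
        · simp only [if_neg g1, if_neg g2, if_neg hne, if_true]; omega
    · intro t h1 h2
      beta_reduce
      by_cases g1 : t < k
      · rw [if_pos g1, if_neg (by omega), if_neg (by omega)]; exact hne.symm
      · rw [if_neg g1, if_pos (by omega), if_neg (by omega), if_neg (by omega)]; exact hj2.1
  · push Not at hB
    have hsum : ∑ j, Function.update r j0 0 j = k + 1 := by
      rw [Finset.sum_update_of_mem (Finset.mem_univ _), Finset.sdiff_singleton_eq_erase, hrest, zero_add]
    obtain ⟨a, c, hc⟩ := intervals _ _ hsum hp
    have hc0 : ∀ i < k + 1, c i ≠ j0 := by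
      intro i hi h
      have := hc i hi
      rw [h, Function.update_self] at this
      omega
    refine ⟨fun j => if j = j0 then 0 else a j + k, fun i => if i < k then j0 else c (i - k), ?_, ?_⟩
    · intro i hi
      by_cases g1 : i < k
      · simp only [if_pos g1, if_true]; omega
      · have g2 := hc0 (i-k) (by omega)
        have := hc (i-k) (by omega)
        rw [Function.update_of_ne g2] at this
        simp only [if_neg g1, if_neg g2]; omega
    · intro t h1 h2
      beta_reduce
      by_cases g1 : t < k
      · rw [if_pos g1, if_neg (by omega)]; exact (hc0 _ (by omega)).symm
      · rw [if_neg g1, if_neg (by omega)]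
        intro he
        have e1 := hc (t - k) (by omega)
        have e2 := hc (t + k - 1 - k) (by omega)
        rw [he] at e1
        have g2 := hc0 (t+k-1-k) (by omega)
        rw [Function.update_of_ne g2] at e1 e2
        have := hB _ g2
        have := hr (c (t+k-1-k))
        omega

lemma caseIII_even {n k p : ℕ} (hn : 0 < n) (hk : 0 < k) (hnk : n = 2 * k) (r : Fin p → ℕ) (hr : ∀ j, 2 * r j ≤ n)
    (hs : ∑ j, r j = n + 1) : Good n p hn r := by
  obtain ⟨a, c, hc, hbad⟩ := good_color hk r (fun j => by have := hr j; omega) (by omega)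
  have hdiff : ∀ i j, i < n + 1 → j < n + 1 → i + k ≤ j ∨ (2 ≤ i ∧ i ≤ k ∧ j = i + k - 1) → c i ≠ c j := by
    intro i j hi hj hij
    rcases hij with hij | ⟨g1, g2, g3⟩
    · intro he
      have h1 := hc i (by omega)
      have h2 := hc j (by omega)
      rw [he] at h1
      have := hr (c j)
      omega
    · rw [g3]; exact hbad i g1 g2
  let idx : ℕ → ℕ := fun s => if s % 2 = 0 then s / 2 else if s = 1 then 2 * k else k + s / 2
  have hE : ∀ s, s % 2 = 0 → idx s = s / 2 := fun s h => if_pos h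
  have hO1 : idx 1 = 2 * k := by simp [idx]
  have hO : ∀ s, s % 2 = 1 → s ≠ 1 → idx s = k + s / 2 := by
    intro s h h'; simp only [idx]; rw [if_neg (by omega), if_neg h']
  have hb : ∀ s ≤ n, idx s < n + 1 := by
    intro s hs; simp only [idx]; split_ifs <;> omega
  have he : ∀ s s', s ≤ n → s' ≤ n → (idx s + k ≤ idx s' ∨ idx s' + k ≤ idx s ∨
      (2 ≤ idx s ∧ idx s ≤ k ∧ idx s' = idx s + k - 1) ∨ (2 ≤ idx s' ∧ idx s' ≤ k ∧ idx s = idx s' + k - 1)) →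
      c (idx s) ≠ c (idx s') := by
    intro s s' h1 h2 h3
    rcases h3 with h3 | h3 | h3 | h3
    · exact hdiff _ _ (hb s h1) (hb s' h2) (Or.inl h3)
    · exact (hdiff _ _ (hb s' h2) (hb s h1) (Or.inl h3)).symm
    · exact hdiff _ _ (hb s h1) (hb s' h2) (Or.inr h3)
    · exact (hdiff _ _ (hb s' h2) (hb s h1) (Or.inr h3)).symm
  refine slots hn (by omega) r hr (fun s => c (idx s)) a idx (fun s hs => hc _ (by have := hb s hs; omega)) ?_ ?_ ?_ ?_ ?_ ?_ ?_
  · intro s hs s' hs' h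
    simp only [idx] at h
    split_ifs at h <;> omega
  · intro s h1 h2
    apply he s (s+1) (by omega) (by omega)
    rcases Nat.mod_two_eq_zero_or_one s with g | g
    · rw [hE s g, hO (s+1) (by omega) (by omega)]; omega
    · by_cases g1 : s = 1
      · rw [g1, hO1, hE (1+1) (by omega)]; omega
      · rw [hO s g g1, hE (s+1) (by omega)]; omega
  · refine he (n-1) 0 (by omega) (by omega) ?_
    by_cases g1 : n - 1 = 1
    · rw [g1, hO1, hE 0 (by omega)]; omega
    · rw [hO (n-1) (by omega) g1, hE 0 (by omega)]; omega
  · refine he (n-1) n (by omega) (by omega) ?_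
    by_cases g1 : n - 1 = 1
    · rw [g1, hO1, hE n (by omega)]; omega
    · rw [hO (n-1) (by omega) g1, hE n (by omega)]; omega
  · exact he 1 0 (by omega) (by omega) (by rw [hO1, hE 0 (by omega)]; omega)
  · exact he 1 n (by omega) (by omega) (by rw [hO1, hE n (by omega)]; omega)
  · exact he 0 n (by omega) (by omega) (by rw [hE 0 (by omega), hE n (by omega)]; omega)

end CaseIII

section CaseII

def gcol (n : ℕ) (i : ℕ) : Fin n → ℂ := if i = n - 1 then - ev n 0 else ev n (i+1)
def hcol (n : ℕ) (i : ℕ) : Fin n → ℂ := if i % 2 = 1 then ev n (i+1) else if i = n - 1 then ev n 0 else 0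

lemma hcol_Ty {n m : ℕ} (hm : 0 < m) (hnm : n = 2 * m + 1) : Ty m (colM (hcol n) : Matrix (Fin n) (Fin n) ℂ) := by
  have ho : ∀ i < n, i % 2 = 1 → colM (hcol n) *ᵥ ev n i = ev n (i+1) := by
    intro i hi h; rw [colM_ev _ _ hi]; simp only [hcol]; rw [if_pos h]
  have hl : colM (hcol n) *ᵥ ev n (n-1) = ev n 0 := by
    rw [colM_ev _ _ (by omega)]; simp only [hcol]; rw [if_neg (by omega), if_pos trivial]
  have he : ∀ i < n, i % 2 = 0 → i ≠ n - 1 → colM (hcol n) *ᵥ ev n i = 0 := by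
    intro i hi h h'; rw [colM_ev _ _ hi]; simp only [hcol]; rw [if_neg (by omega), if_neg h']
  let s : ℕ → ℕ := fun k => 2 + (if k = m-1 then 1 else 0)
  apply cone_of_chains (ι := Fin m) (by simp) (colM (hcol n)) (fun k => s k)
    (fun k l => if l = 0 then ev n (2*k+1) else if l = 1 then ev n (2*k+2) else ev n 0)
  · rw [Fin.sum_univ_eq_sum_range s m]
    simp only [s]
    rw [Finset.sum_add_distrib, Finset.sum_ite_eq', if_pos (Finset.mem_range.2 (by omega))]
    simp; omega
  · intro i j
    simp only [s]
    split_ifs <;> omega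
  · intro k l hl'
    have hk := k.2
    have hl3 : l = 0 ∨ (l = 1 ∧ (k:ℕ) = m-1) := by
      simp only [s] at hl'
      split_ifs at hl' <;> omega
    rcases hl3 with rfl | ⟨rfl, h⟩
    · simp only [if_true, zero_add, one_ne_zero, if_false]
      rw [ho _ (by omega) (by omega)]
    · simp only [if_true, Nat.reduceAdd, one_ne_zero, if_false, OfNat.ofNat_ne_zero, OfNat.ofNat_ne_one]
      rw [show 2 * (k:ℕ) + 2 = n - 1 by omega, hl]
  · intro k l hl'
    have hk := k.2
    have hl3 : (l = 1 ∧ (k:ℕ) ≠ m-1) ∨ (l = 2 ∧ (k:ℕ) = m-1) := by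
      simp only [s] at hl'
      split_ifs at hl' <;> omega
    rcases hl3 with ⟨rfl, h1⟩ | ⟨rfl, h⟩
    · simp only [if_true, one_ne_zero, if_false]
      rw [he _ (by omega) (by omega) (by omega)]
    · simp only [if_false, OfNat.ofNat_ne_zero, OfNat.ofNat_ne_one]
      rw [he _ (by omega) (by omega) (by omega)]
  · intro W hW
    apply ev_top
    intro i hi
    rcases Nat.eq_zero_or_pos i with rfl | h
    · have := hW ⟨m-1, by omega⟩ 2 (by simp only [s, if_true]; omega)
      simpa using this
    · have := hW ⟨(i-1)/2, by omega⟩ ((i-1) % 2) (by simp only [s]; omega)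
      rcases Nat.mod_two_eq_zero_or_one (i-1) with h' | h'
      · simp only [h', if_true] at this
        rwa [show 2 * ((i-1)/2) + 1 = i by omega] at this
      · simp only [h', if_true, one_ne_zero, if_false] at this
        rwa [show 2 * ((i-1)/2) + 2 = i by omega] at this

lemma gcol_Ty {n m : ℕ} (hm : 0 < m) (hnm : n = 2 * m + 1) :
    Ty m (colM (fun i => if i % 2 = 0 then gcol n i else 0) : Matrix (Fin n) (Fin n) ℂ) := by
  set c : ℕ → Fin n → ℂ := fun i => if i % 2 = 0 then gcol n i else 0 with hc
  have he : ∀ i < n, i % 2 = 0 → i ≠ n - 1 → colM c *ᵥ ev n i = ev n (i+1) := by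
    intro i hi h h'; rw [colM_ev _ _ hi]; simp only [hc, gcol]; rw [if_pos h, if_neg h']
  have hl : colM c *ᵥ ev n (n-1) = - ev n 0 := by
    rw [colM_ev _ _ (by omega)]; simp only [hc, gcol]; rw [if_pos (by omega), if_pos trivial]
  have ho : ∀ i < n, i % 2 = 1 → colM c *ᵥ ev n i = 0 := by
    intro i hi h; rw [colM_ev _ _ hi]; simp only [hc]; rw [if_neg (by omega)]
  let s : ℕ → ℕ := fun k => 2 + (if k = 0 then 1 else 0)
  apply cone_of_chains (ι := Fin m) (by simp) (colM c) (fun k => s k)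
    (fun k l => if (k:ℕ) = 0 then (if l = 0 then ev n (n-1) else if l = 1 then - ev n 0 else - ev n 1) else
      if l = 0 then ev n (2*k) else ev n (2*k+1))
  · rw [Fin.sum_univ_eq_sum_range s m]
    simp only [s]
    rw [Finset.sum_add_distrib, Finset.sum_ite_eq', if_pos (Finset.mem_range.2 (by omega))]
    simp; omega
  · intro i j
    simp only [s]
    split_ifs <;> omega
  · intro k l hl'
    have hk := k.2
    by_cases h : (k:ℕ) = 0
    · simp only [s, if_pos h] at hl' ⊢
      rcases (by omega : l = 0 ∨ l = 1) with rfl | rfl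
      · simp [hl]
      · simp [Matrix.mulVec_neg, he 0 (by omega) (by omega) (by omega)]
    · simp only [s, if_neg h] at hl' ⊢
      obtain rfl : l = 0 := by omega
      simp [he (2*k) (by omega) (by omega) (by omega)]
  · intro k l hl'
    have hk := k.2
    by_cases h : (k:ℕ) = 0
    · simp only [s, if_pos h] at hl' ⊢
      obtain rfl : l = 2 := by omega
      simp [Matrix.mulVec_neg, ho 1 (by omega) (by omega)]
    · simp only [s, if_neg h] at hl' ⊢
      obtain rfl : l = 1 := by omega
      simp [ho (2*k+1) (by omega) (by omega)]
  · intro W hW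
    apply ev_top
    intro i hi
    by_cases h1 : i = n - 1
    · have := hW ⟨0, hm⟩ 0 (by simp only [s]; omega)
      simpa [h1] using this
    rcases (by omega : i = 0 ∨ i = 1 ∨ 2 ≤ i) with rfl | rfl | h
    · have := hW ⟨0, hm⟩ 1 (by simp only [s]; omega)
      simpa using this
    · have := hW ⟨0, hm⟩ 2 (by simp [s])
      simpa using this
    · have := hW ⟨i/2, by omega⟩ (i % 2) (by simp only [s]; omega)
      simp only [if_neg (show ¬ i / 2 = 0 by omega)] at this
      rcases Nat.mod_two_eq_zero_or_one i with h' | h'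
      · simp only [h', if_true] at this
        rwa [show 2 * (i/2) = i by omega] at this
      · simp only [h', one_ne_zero, if_false] at this
        rwa [show 2 * (i/2) + 1 = i by omega] at this

lemma caseII_core {n m p : ℕ} (hn : 0 < n) (hm : 0 < m) (hnm : n = 2 * m + 1) (r : Fin p → ℕ) (j0 : Fin p)
    (hr0 : r j0 = m + 1) (C : ℕ → Fin p) (hC : ∀ i ≤ m, C i ≠ j0)
    (hT : ∀ j, j ≠ j0 → Ty (n - r j) (colM (fun i => if i % 2 = 0 then (if C (i/2) = j then gcol n i else 0) else 0) :
      Matrix (Fin n) (Fin n) ℂ)) : Good n p hn r := by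
  classical
  let d : Fin p → ℕ → Fin n → ℂ := fun j i => if j = j0 then hcol n i else
    if i % 2 = 0 then (if C (i/2) = j then gcol n i else 0) else 0
  have hd : ∀ i < n, ∀ j, d j i = (if j = j0 then hcol n i else 0) +
      (if C (i/2) = j then (if i % 2 = 0 then gcol n i else 0) else 0) := by
    intro i hi j
    simp only [d]
    have := hC (i/2) (by omega)
    by_cases h : j = j0
    · subst h; rw [if_pos rfl, if_pos rfl, if_neg this, add_zero]
    · rw [if_neg h, if_neg h, zero_add]; split_ifs <;> rfl
  have hsum : ∀ i < n, ∑ j, d j i = if i + 1 < n then ev n (i+1) else 0 := by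
    intro i hi
    rw [Finset.sum_congr rfl (fun j _ => hd i hi j), Finset.sum_add_distrib, Finset.sum_ite_eq', Finset.sum_ite_eq,
      if_pos (Finset.mem_univ _), if_pos (Finset.mem_univ _)]
    simp only [hcol, gcol]
    rcases Nat.mod_two_eq_zero_or_one i with h | h
    · rw [if_neg (by omega), if_pos h]
      by_cases h' : i = n - 1
      · rw [if_pos h', if_pos h', if_neg (by omega)]; simp
      · rw [if_neg h', if_neg h', if_pos (by omega)]; simp
    · rw [if_pos h, if_neg (by omega), if_pos (by omega)]; simp
  refine ⟨fun j => colM (d j), fun l => ev n l, ?_, ?_, ?_, ?_, ?_, j0, ?_⟩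
  · intro j
    by_cases h : j = j0
    · subst h
      have := hcol_Ty hm hnm
      simp only [d, if_true]
      rw [hr0, show n - (m+1) = m by omega]
      exact this
    · have := hT j h
      simp only [d, if_neg h]
      exact this
  · intro l hl
    rw [colM_sum, colM_ev _ _ (by omega), hsum _ (by omega), if_pos hl]
  · rw [colM_sum, colM_ev _ _ (by omega), hsum _ (by omega), if_neg (by omega)]
  · intro W hW; exact ev_top W hW
  · intro l g1 g2
    exact ev0 _ (by omega)
  · rw [colM_ev _ _ (by omega)]
    simp only [d, hcol]
    rw [if_pos trivial, if_neg (by omega), if_pos trivial]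
    simp [ev00]

lemma caseII {n m p : ℕ} (hn : 0 < n) (hm : 0 < m) (hnm : n = 2 * m + 1) (r : Fin p → ℕ) (j0 : Fin p)
    (hr0 : r j0 = m + 1) (hs : ∑ j, r j = n + 1) : Good n p hn r := by
  classical
  have hrest : ∑ j ∈ Finset.univ.erase j0, r j = m + 1 := by
    have := Finset.add_sum_erase Finset.univ r (Finset.mem_univ j0)
    omega
  by_cases hA : ∃ j1, j1 ≠ j0 ∧ r j1 = m + 1
  · obtain ⟨j1, hne, hj1⟩ := hA
    apply caseII_core hn hm hnm r j0 hr0 (fun _ => j1) (fun _ _ => hne)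
    intro j hj
    by_cases h : j1 = j
    · subst h
      have := gcol_Ty hm hnm
      simp only [if_true]
      rw [hj1, show n - (m+1) = m by omega]
      exact this
    · apply Ty_bip _ ∅ (by simp) (by simp)
      intro x y hxy
      simp [colM, h] at hxy
  · push Not at hA
    have hle : ∀ j, j ≠ j0 → r j ≤ m := by
      intro j hj
      have h1 := hA j hj
      have h2 : r j ≤ ∑ j ∈ Finset.univ.erase j0, r j :=
        Finset.single_le_sum (f := r) (fun _ _ => Nat.zero_le _) (Finset.mem_erase.2 ⟨hj, Finset.mem_univ _⟩)
      omega
    have hsum : ∑ j, Function.update r j0 0 j = m + 1 := by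
      rw [Finset.sum_update_of_mem (Finset.mem_univ _), Finset.sdiff_singleton_eq_erase, hrest, zero_add]
    obtain ⟨a, c, hc⟩ := intervals _ _ hsum (Nat.pos_of_ne_zero (by rintro rfl; exact j0.elim0))
    have hc0 : ∀ i ≤ m, c i ≠ j0 := by
      intro i hi h
      have := hc i (by omega)
      rw [h, Function.update_self] at this
      omega
    apply caseII_core hn hm hnm r j0 hr0 c hc0
    intro j hj
    have hcj : ∀ i ≤ m, c i = j → a j ≤ i ∧ i < a j + r j := by
      intro i hi h
      have := hc i (by omega)
      rw [h, Function.update_of_ne hj] at this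
      exact this
    let L : Finset (Fin n) := Finset.univ.filter (fun x => (x:ℕ) % 2 = 0 ∧ c (x/2) = j)
    have hcard : L.card ≤ r j := by
      have : L.card ≤ (Finset.Ico (a j) (a j + r j)).card := by
        apply Finset.card_le_card_of_injOn (fun x : Fin n => (x:ℕ)/2)
        · intro x hx
          have hx' : (x:ℕ) % 2 = 0 ∧ c (x/2) = j := by simpa [L] using hx
          have := hcj (x/2) (by omega) hx'.2
          simpa using this
        · intro x hx x' hx' hxx
          have h1 : (x:ℕ) % 2 = 0 ∧ c (x/2) = j := by simpa [L] using hx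
          have h2 : (x':ℕ) % 2 = 0 ∧ c (x'/2) = j := by simpa [L] using hx'
          apply Fin.ext
          beta_reduce at hxx
          omega
      simpa using this
    have hrj := hle j hj
    apply Ty_bip _ L hcard (by omega)
    intro x i hxi
    have hxi' : (if (i:ℕ) % 2 = 0 then (if c (i/2) = j then gcol n i else 0) else 0 : Fin n → ℂ) x ≠ 0 := hxi
    have hi := i.2
    by_cases g1 : (i:ℕ) % 2 = 0
    · rw [if_pos g1] at hxi'
      by_cases g2 : c (i/2) = j
      · rw [if_pos g2] at hxi'
        simp only [L, Finset.mem_filter, Finset.mem_univ, true_and]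
        refine ⟨⟨g1, g2⟩, ?_⟩
        rintro ⟨g3, g4⟩
        simp only [gcol] at hxi'
        by_cases g5 : (i:ℕ) = n - 1
        · rw [if_pos g5] at hxi'
          have hx := ev_ne_neg hxi'
          have e1 := hcj _ (by omega) g2
          have e2 := hcj _ (by omega) g4
          omega
        · rw [if_neg g5] at hxi'
          have hx := ev_ne hxi'
          omega
      · rw [if_neg g2] at hxi'; simp at hxi'
    · rw [if_neg g1] at hxi'; simp at hxi'

lemma good_all {n p : ℕ} (hn : 0 < n) (hn2 : 2 ≤ n) (r : Fin p → ℕ) (hr : ∀ j, r j + 1 ≤ n)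
    (hs : ∑ j, r j = n + 1) : Good n p hn r := by
  by_cases hA : ∀ j, 2 * r j ≤ n
  · rcases Nat.even_or_odd' n with ⟨k, hk | hk⟩
    · exact caseIII_even hn (by omega) hk r hA hs
    · exact caseIII_odd hn (by omega) hk r hA hs (Nat.pos_of_ne_zero (by rintro rfl; simp at hs))
  · push Not at hA
    obtain ⟨j0, hj0⟩ := hA
    have := hr j0
    by_cases h : n = 2 * (n - r j0) + 1
    · exact caseII hn (m := n - r j0) (by omega) h r j0 (by omega) hs
    · exact caseI hn (m := n - r j0) (by omega) r hs j0 (by omega) (dataI_all hn (by omega) (by omega))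

lemma reduce_sum {p : ℕ} (R : Fin p → ℕ) (M : ℕ) (h : M ≤ ∑ j, R j) :
    ∃ r : Fin p → ℕ, (∀ j, r j ≤ R j) ∧ ∑ j, r j = M := by
  induction p generalizing M with
  | zero => exact ⟨R, fun _ => le_rfl, by simp at h ⊢; omega⟩
  | succ p ih =>
    rw [Fin.sum_univ_succ] at h
    obtain ⟨r, h1, h2⟩ := ih (fun j => R j.succ) (M - min M (R 0)) (by omega)
    refine ⟨Fin.cons (min M (R 0)) r, ?_, ?_⟩
    · intro j
      refine Fin.cases ?_ (fun j => ?_) j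
      · simp
      · simpa using h1 j
    · rw [Fin.sum_univ_succ]
      simp only [Fin.cons_zero, Fin.cons_succ, h2]
      omega

end CaseII

/-- If `c_1` has `n` distinct eigenvalues, the traces sum to zero and
`r_2 + ⋯ + r_{p+1} ≥ n + 1`, then the additive DSP is solvable. -/
theorem stmt2 (n p : ℕ) (hn : 2 ≤ n) (hp : 1 ≤ p)
    (B : Fin (p + 1) → Matrix (Fin n) (Fin n) ℂ)
    (hdist : HasDistinctEigenvalues (B 0))
    (htrace : ∑ j, (B j).trace = 0)
    (hr : n + 1 ≤ ∑ j ∈ Finset.univ.erase 0, rk (B j)) :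
    ∃ A : Fin (p + 1) → Matrix (Fin n) (Fin n) ℂ,
      (∀ j, SameClass (A j) (B j)) ∧ ∑ j, A j = 0 ∧ IrreducibleTuple A := by
  have h1 : n + 1 ≤ ∑ j : Fin p, rk (B j.succ) := by
    have e1 := Finset.add_sum_erase Finset.univ (fun j => rk (B j)) (Finset.mem_univ 0)
    have e2 := Fin.sum_univ_succ (fun j => rk (B j))
    omega
  obtain ⟨r, hr1, hr2⟩ := reduce_sum _ _ h1
  have hn0 : 0 < n := by omega
  exact assemble hn0 B hdist htrace r hr1
    (good_all hn0 hn r (fun j => (Nat.add_le_add_right (hr1 j) 1).trans (rk_lt hn0 _)) hr2)
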